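/- arXiv:2010.10971 — 3 statements merged into one kernel-verified Lean document; each statement's English description precedes it below -/
import Mathlib

section
/- Let ω be smooth and uniformly positive and (φ_ε, θ_ε, y_ε, p_ε) solve the action-angle equations of motion on [0,T] with ε-independent initial data φ_ε(0)=0, θ_ε(0)=θ_*, y_ε(0)=y_*, p_ε(0)=p_*. Then as ε → 0: y_ε → y₀ in C¹([0,T]), p_ε → p₀ in C¹([0,T]), θ_ε → θ_* in C([0,T]), and φ_ε → φ₀ in C¹([0,T]), where (φ₀, y₀, p₀) satisfy φ̇₀ = ω(y₀), ẏ₀ = p₀, ṗ₀ = −θ_* ω'(y₀) with the corresponding initial conditions. In particular ÿ₀ = −θ_* ω'(y₀). -/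
open Real Set Filter Topology

/-- A bounded Lipschitz vector field has an integral curve through any point on a neighbourhood
of `[0, T]`. -/
theorem exists_integralCurve_of_bounded_lipschitz {E : Type*} [NormedAddCommGroup E]
    [NormedSpace ℝ E] [CompleteSpace E] {F : E → E} {K : NNReal} (hF : LipschitzWith K F)
    {L : ℝ} (hL : ∀ x, ‖F x‖ ≤ L) (x₀ : E) {T : ℝ} (hT : 0 ≤ T) :
    ∃ α : ℝ → E, α 0 = x₀ ∧ ∀ t ∈ Ioo (-1) (T + 1), HasDerivAt α (F (α t)) t := by
  have hL0 : 0 ≤ L := (norm_nonneg _).trans (hL x₀)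
  have h0 : (0 : ℝ) ∈ Icc (-1) (T + 1) := ⟨by norm_num, by linarith⟩
  have hPL : IsPicardLindelof (fun _ => F) ⟨0, h0⟩ x₀ ⟨L * (T + 1), by positivity⟩ 0
      ⟨L, hL0⟩ K := by
    refine .of_time_independent (fun x _ => hL x) hF.lipschitzOnWith ?_
    have : max (T + 1 - 0) (0 - (-1)) = T + 1 := by
      rw [sub_zero]; exact max_eq_left (by linarith)
    change L * max (T + 1 - 0) (0 - (-1)) ≤ L * (T + 1) - 0
    rw [this, sub_zero]
  obtain ⟨α, hα0, hα⟩ := hPL.exists_eq_forall_mem_Icc_hasDerivWithinAt₀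
  exact ⟨α, hα0, fun t ht => (hα t (Ioo_subset_Icc_self ht)).hasDerivAt (Icc_mem_nhds ht.1 ht.2)⟩

/-- Truncating the argument of a `C¹` function makes it Lipschitz and bounded. -/
theorem ContDiff.exists_lipschitzWith_comp_projIcc {f : ℝ → ℝ} (hf : ContDiff ℝ 1 f) {a b : ℝ}
    (h : a ≤ b) :
    ∃ K : NNReal, ∃ C : ℝ, LipschitzWith K (fun x => f (projIcc a b h x)) ∧
      ∀ x, |f (projIcc a b h x)| ≤ C := by
  obtain ⟨K, hK⟩ := hf.contDiffOn.exists_lipschitzOnWith one_ne_zero (convex_Icc a b) isCompact_Icc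
  obtain ⟨C, hC⟩ := isCompact_Icc.exists_bound_of_continuousOn (s := Icc a b)
    hf.continuous.continuousOn
  refine ⟨K * 1, C, ?_, fun x => hC _ (projIcc a b h x).2⟩
  exact hK.to_restrict.comp (LipschitzWith.projIcc h)

/-- Solutions of a scalar linear equation preserve the sign of their initial value. -/
theorem nonneg_of_hasDerivAt_mul_self {f g : ℝ → ℝ} {T : ℝ} (hg : Continuous g)
    (hf : ∀ t ∈ Icc 0 T, HasDerivAt f (g t * f t) t) (h0 : 0 ≤ f 0) :
    ∀ t ∈ Icc 0 T, 0 ≤ f t := by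
  set G : ℝ → ℝ := fun t => ∫ s in (0 : ℝ)..t, g s
  have hG : ∀ t, HasDerivAt G (g t) t := fun t => hg.integral_hasStrictDerivAt 0 t |>.hasDerivAt
  have hd : ∀ t ∈ Icc 0 T, HasDerivAt (fun t => f t * exp (-G t)) 0 t := fun t ht => by
    refine ((hf t ht).mul (hG t).neg.exp).congr_deriv ?_
    simp only [Pi.neg_apply]
    ring
  intro t ht
  have := constant_of_has_deriv_right_zero (fun s hs => (hd s hs).continuousAt.continuousWithinAt)
    (fun s hs => (hd s (Ico_subset_Icc_self hs)).hasDerivWithinAt) t ht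
  have h1 : 0 ≤ f t * exp (-G t) := by
    rw [this]; positivity
  exact nonneg_of_mul_nonneg_left h1 (exp_pos _)

/-- Approximate integral curves of a Lipschitz vector field whose defect is `O(ε)` converge
in `C¹`, as `ε → 0⁺`, to the integral curve with the same initial value. -/
theorem tendstoUniformlyOn_of_approx_integralCurve {E : Type*} [NormedAddCommGroup E]
    [NormedSpace ℝ E] {F : E → E} {K : NNReal} (hF : LipschitzWith K F) {T C : ℝ}
    {α : ℝ → E} (hα : ∀ t ∈ Icc 0 T, HasDerivAt α (F (α t)) t)
    {X X' : ℝ → ℝ → E} (hX : ∀ ε ∈ Ioc (0 : ℝ) 1, ∀ t ∈ Icc 0 T, HasDerivAt (X ε) (X' ε t) t)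
    (hX' : ∀ ε ∈ Ioc (0 : ℝ) 1, ∀ t ∈ Icc 0 T, ‖X' ε t - F (X ε t)‖ ≤ C * ε)
    (h0 : ∀ ε ∈ Ioc (0 : ℝ) 1, X ε 0 = α 0) :
    TendstoUniformlyOn X α (𝓝[>] 0) (Icc 0 T) ∧
      TendstoUniformlyOn X' (fun t => F (α t)) (𝓝[>] 0) (Icc 0 T) := by
  have hsmall : ∀ᶠ ε : ℝ in 𝓝[>] 0, ε ∈ Ioc (0 : ℝ) 1 := Ioc_mem_nhdsGT one_pos
  have hCε : Tendsto (fun ε : ℝ => C * ε) (𝓝[>] 0) (𝓝 0) :=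
    (Continuous.tendsto' (by fun_prop) 0 0 (by simp)).mono_left nhdsWithin_le_nhds
  have hXα : TendstoUniformlyOn X α (𝓝[>] 0) (Icc 0 T) := by
    rw [Metric.tendstoUniformlyOn_iff]
    intro η hη
    have hlim : Tendsto (fun ε : ℝ => gronwallBound 0 K (C * ε + 0) T) (𝓝[>] 0) (𝓝 0) := by
      have := ((gronwallBound_continuous_ε 0 K T).tendsto 0).comp
        (by simpa using hCε.add_const 0 : Tendsto (fun ε : ℝ => C * ε + 0) (𝓝[>] 0) (𝓝 0))
      simpa [Function.comp_def, gronwallBound_ε0_δ0] using this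
    filter_upwards [hsmall, hlim.eventually_lt_const hη] with ε hε hlt t ht
    have hC0 : 0 ≤ C * ε := (norm_nonneg _).trans (hX' ε hε t ht)
    rw [dist_comm]
    refine lt_of_le_of_lt ?_ hlt
    have h := dist_le_of_approx_trajectories_ODE (v := fun _ => F) (f := X ε) (g := α)
      (fun _ => hF) (δ := 0) (εf := C * ε) (εg := 0)
      (fun s hs => (hX ε hε s hs).continuousAt.continuousWithinAt)
      (fun s hs => (hX ε hε s (Ico_subset_Icc_self hs)).hasDerivWithinAt)
      (fun s hs => by
        rw [dist_eq_norm]; exact hX' ε hε s (Ico_subset_Icc_self hs))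
      (fun s hs => (hα s hs).continuousAt.continuousWithinAt)
      (fun s hs => (hα s (Ico_subset_Icc_self hs)).hasDerivWithinAt)
      (fun s _ => by simp) (by simp [h0 ε hε]) t ht
    exact h.trans (gronwallBound_mono le_rfl (by simpa using hC0) K.2 (by linarith [ht.2]))
  refine ⟨hXα, ?_⟩
  have hFX := hF.uniformContinuous.comp_tendstoUniformlyOn hXα
  rw [Metric.tendstoUniformlyOn_iff] at hFX ⊢
  intro η hη
  filter_upwards [hsmall, hFX (η / 2) (half_pos hη), hCε.eventually_lt_const (half_pos hη)]
    with ε hε h1 h2 t ht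
  have h3 := hX' ε hε t ht
  have h4 := h1 t ht
  rw [dist_comm] at h4 ⊢
  calc dist (X' ε t) (F (α t)) ≤ dist (X' ε t) (F (X ε t)) + dist (F (X ε t)) (F (α t)) :=
        dist_triangle _ _ _
    _ < η := by
        rw [dist_eq_norm (X' ε t)]
        simp only [Function.comp_apply] at h4
        linarith

/-- The velocity `ẏ` of the slow variable in action-angle coordinates. -/
noncomputable def slowVelocity (ω : ℝ → ℝ) (ε : ℝ) (φ θ y p : ℝ → ℝ) (t : ℝ) : ℝ :=
  p t + ε / 2 * (θ t * logDeriv ω (y t) * sin (2 * φ t / ε))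

/-- Solutions on `[0, T]` of the canonical equations of the Hamiltonian
`(p + (ε/2) θ (ω'/ω)(y) sin (2φ/ε))² / 2 + θ ω(y)`. -/
structure IsActionAngleSolution (ω : ℝ → ℝ) (T ε : ℝ) (φ θ y p : ℝ → ℝ) : Prop where
  continuous_φ : Continuous φ
  continuous_θ : Continuous θ
  continuous_y : Continuous y
  continuous_p : Continuous p
  hasDerivAt_φ : ∀ t ∈ Icc 0 T, HasDerivAt φ (ω (y t) +
    ε / 2 * (logDeriv ω (y t) * slowVelocity ω ε φ θ y p t * sin (2 * φ t / ε))) t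
  hasDerivAt_θ : ∀ t ∈ Icc 0 T, HasDerivAt θ
    (-(θ t * slowVelocity ω ε φ θ y p t * logDeriv ω (y t) * cos (2 * φ t / ε))) t
  hasDerivAt_y : ∀ t ∈ Icc 0 T, HasDerivAt y (slowVelocity ω ε φ θ y p t) t
  hasDerivAt_p : ∀ t ∈ Icc 0 T, HasDerivAt p (-(θ t * deriv ω (y t)) - ε / 2 *
    (slowVelocity ω ε φ θ y p t * θ t * deriv (logDeriv ω) (y t) * sin (2 * φ t / ε))) t

theorem contDiff_logDeriv {ω : ℝ → ℝ} (hω : ContDiff ℝ (⊤ : ℕ∞) ω) (hpos : ∀ x, 0 < ω x) :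
    ContDiff ℝ (⊤ : ℕ∞) (logDeriv ω) :=
  (contDiff_infty_iff_deriv.1 hω).2.div hω fun x => (hpos x).ne'

namespace IsActionAngleSolution

variable {ω : ℝ → ℝ} {T ε : ℝ} {φ θ y p : ℝ → ℝ}

theorem hasDerivAt_sin (h : IsActionAngleSolution ω T ε φ θ y p) (hε : ε ≠ 0) {t : ℝ}
    (ht : t ∈ Icc 0 T) :
    HasDerivAt (fun t => sin (2 * φ t / ε)) (cos (2 * φ t / ε) * (2 / ε * (ω (y t) +
      ε / 2 * (logDeriv ω (y t) * slowVelocity ω ε φ θ y p t * sin (2 * φ t / ε))))) t := by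
  convert (((h.hasDerivAt_φ t ht).const_mul 2).div_const ε).sin using 1
  field_simp

theorem continuous_slowVelocity (h : IsActionAngleSolution ω T ε φ θ y p)
    (hω : ContDiff ℝ (⊤ : ℕ∞) ω) (hpos : ∀ x, 0 < ω x) :
    Continuous (slowVelocity ω ε φ θ y p) := by
  have h1 := (contDiff_logDeriv hω hpos).continuous.comp h.continuous_y
  have := h.continuous_φ
  have := h.continuous_θ
  have := h.continuous_p
  unfold slowVelocity
  simp only [Function.comp_def] at h1
  fun_prop

theorem nonneg_action (h : IsActionAngleSolution ω T ε φ θ y p)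
    (hω : ContDiff ℝ (⊤ : ℕ∞) ω) (hpos : ∀ x, 0 < ω x) (h0 : 0 ≤ θ 0) :
    ∀ t ∈ Icc 0 T, 0 ≤ θ t := by
  have h1 := (contDiff_logDeriv hω hpos).continuous.comp h.continuous_y
  have h2 := h.continuous_slowVelocity hω hpos
  have := h.continuous_φ
  simp only [Function.comp_def] at h1
  refine nonneg_of_hasDerivAt_mul_self
    (g := fun t => -(slowVelocity ω ε φ θ y p t * logDeriv ω (y t) * cos (2 * φ t / ε)))
    (by fun_prop) (fun t ht => ?_) h0
  convert h.hasDerivAt_θ t ht using 1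
  ring

/-- Conservation of energy. -/
theorem energy_eq (h : IsActionAngleSolution ω T ε φ θ y p) (hε : ε ≠ 0)
    (hω : ContDiff ℝ (⊤ : ℕ∞) ω) (hpos : ∀ x, 0 < ω x) :
    ∀ t ∈ Icc 0 T, slowVelocity ω ε φ θ y p t ^ 2 / 2 + θ t * ω (y t) =
      slowVelocity ω ε φ θ y p 0 ^ 2 / 2 + θ 0 * ω (y 0) := by
  have hd : ∀ t ∈ Icc 0 T, HasDerivAt
      (fun t => slowVelocity ω ε φ θ y p t ^ 2 / 2 + θ t * ω (y t)) 0 t := by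
    intro t ht
    have hθ := h.hasDerivAt_θ t ht
    have hy := h.hasDerivAt_y t ht
    have hωy := ((hω.differentiable (by simp)) (y t)).hasDerivAt.comp t hy
    have hay := (((contDiff_logDeriv hω hpos).differentiable (by simp)) (y t)).hasDerivAt.comp t hy
    have hw := (h.hasDerivAt_p t ht).add
      (((hθ.mul hay).mul (h.hasDerivAt_sin hε ht)).const_mul (ε / 2))
    have hE := ((hw.pow 2).div_const 2).add (hθ.mul hωy)
    refine (hE.congr_deriv ?_)
    have hω' : deriv ω (y t) = logDeriv ω (y t) * ω (y t) := by
      rw [logDeriv_apply, div_mul_cancel₀ _ (hpos _).ne']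
    have hwdef : (p t + ε / 2 * (θ t * logDeriv ω (y t) * sin (2 * φ t / ε))) =
      slowVelocity ω ε φ θ y p t := rfl
    simp only [Pi.add_apply, Pi.mul_apply, Function.comp_apply, hwdef, hω']
    generalize slowVelocity ω ε φ θ y p t = w
    field_simp
    ring
  exact constant_of_has_deriv_right_zero (fun s hs => (hd s hs).continuousAt.continuousWithinAt)
    (fun s hs => (hd s (Ico_subset_Icc_self hs)).hasDerivWithinAt)

end IsActionAngleSolution

theorem abs_mul_le_mul {x y A B : ℝ} (hx : |x| ≤ A) (hy : |y| ≤ B) : |x * y| ≤ A * B := by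
  rw [abs_mul]
  exact mul_le_mul hx hy (abs_nonneg _) ((abs_nonneg _).trans hx)

namespace IsActionAngleSolution

variable {ω : ℝ → ℝ} {T ε : ℝ} {φ θ y p : ℝ → ℝ}

/-- All coefficients occurring in the equations of motion along a solution are bounded by `N`. -/
structure BoundedBy (ω : ℝ → ℝ) (ε : ℝ) (φ θ y p : ℝ → ℝ) (N t : ℝ) : Prop where
  velocity : |slowVelocity ω ε φ θ y p t| ≤ N
  action : |θ t| ≤ N
  position : |y t| ≤ N
  momentum : |p t| ≤ N
  deriv_frequency : |deriv ω (y t)| ≤ N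
  logDeriv_frequency : |logDeriv ω (y t)| ≤ N
  deriv_logDeriv : |deriv (logDeriv ω) (y t)| ≤ N
  quotient : |(logDeriv ω / ω) (y t)| ≤ N
  deriv_quotient : |deriv (logDeriv ω / ω) (y t)| ≤ N

theorem exists_boundedBy (hω : ContDiff ℝ (⊤ : ℕ∞) ω) {ωs : ℝ} (hωs : 0 < ωs)
    (hlb : ∀ x, ωs ≤ ω x) {θs : ℝ} (hθs : 0 ≤ θs) (ys ps : ℝ) (hT : 0 ≤ T) :
    ∃ N : ℝ, ∀ ε ∈ Ioc (0 : ℝ) 1, ∀ φ θ y p : ℝ → ℝ, IsActionAngleSolution ω T ε φ θ y p →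
      φ 0 = 0 → θ 0 = θs → y 0 = ys → p 0 = ps →
      ∀ t ∈ Icc 0 T, BoundedBy ω ε φ θ y p N t := by
  have hpos : ∀ x, 0 < ω x := fun x => hωs.trans_le (hlb x)
  have ha := contDiff_logDeriv hω hpos
  have hb : ContDiff ℝ (⊤ : ℕ∞) (logDeriv ω / ω) := ha.div hω fun x => (hpos x).ne'
  set E := ps ^ 2 / 2 + θs * ω ys with hE
  have hE0 : 0 ≤ E := by have := (hpos ys).le; positivity
  set V := E + 1
  have hbound (f : ℝ → ℝ) (hf : ContDiff ℝ (⊤ : ℕ∞) f) :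
      ∃ C, 0 ≤ C ∧ ∀ x ∈ Icc (ys - V * T) (ys + V * T), |f x| ≤ C := by
    obtain ⟨C, hC⟩ := isCompact_Icc.exists_bound_of_continuousOn (f := f)
      (s := Icc (ys - V * T) (ys + V * T)) hf.continuous.continuousOn
    exact ⟨|C|, abs_nonneg C, fun x hx => (hC x hx).trans (le_abs_self C)⟩
  obtain ⟨B₁, hB₁, hB₁'⟩ := hbound _ (contDiff_infty_iff_deriv.1 hω).2
  obtain ⟨B₂, hB₂, hB₂'⟩ := hbound _ ha
  obtain ⟨B₃, hB₃, hB₃'⟩ := hbound _ (contDiff_infty_iff_deriv.1 ha).2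
  obtain ⟨B₄, hB₄, hB₄'⟩ := hbound _ hb
  obtain ⟨B₅, hB₅, hB₅'⟩ := hbound _ (contDiff_infty_iff_deriv.1 hb).2
  have hV0 : 0 ≤ V := by linarith
  have hΘ : 0 ≤ E / ωs := by positivity
  have hVT : 0 ≤ V * T := by positivity
  have hΘB : 0 ≤ E / ωs * B₂ := by positivity
  have hys := abs_nonneg ys
  refine ⟨V + E / ωs + E / ωs * B₂ + (|ys| + V * T) + B₁ + B₂ + B₃ + B₄ + B₅, ?_⟩
  intro ε hε φ θ y p h hφ0 hθ0 hy0 hp0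
  have henergy : ∀ t ∈ Icc 0 T, slowVelocity ω ε φ θ y p t ^ 2 / 2 + θ t * ω (y t) = E := by
    intro t ht
    rw [h.energy_eq hε.1.ne' hω hpos t ht, hE]
    simp [slowVelocity, hφ0, hθ0, hy0, hp0]
  have hθ := h.nonneg_action hω hpos (hθ0 ▸ hθs)
  have hv : ∀ t ∈ Icc 0 T, |slowVelocity ω ε φ θ y p t| ≤ V := by
    intro t ht
    refine abs_le_of_sq_le_sq ?_ hV0
    nlinarith [henergy t ht, mul_nonneg (hθ t ht) (hpos (y t)).le]
  have hθE : ∀ t ∈ Icc 0 T, |θ t| ≤ E / ωs := by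
    intro t ht
    rw [abs_of_nonneg (hθ t ht), le_div_iff₀ hωs]
    nlinarith [henergy t ht, mul_le_mul_of_nonneg_left (hlb (y t)) (hθ t ht),
      sq_nonneg (slowVelocity ω ε φ θ y p t)]
  have hy : ∀ t ∈ Icc 0 T, |y t - ys| ≤ V * T := by
    intro t ht
    have := norm_image_sub_le_of_norm_deriv_le_segment'
      (fun s hs => (h.hasDerivAt_y s hs).hasDerivWithinAt)
      (fun s hs => hv s (Ico_subset_Icc_self hs)) t ht
    rw [hy0] at this
    exact this.trans (mul_le_mul_of_nonneg_left (by linarith [ht.2]) hV0)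
  intro t ht
  have hyI : y t ∈ Icc (ys - V * T) (ys + V * T) := by
    have := abs_le.1 (hy t ht)
    constructor <;> linarith
  have hp : |p t| ≤ V + E / ωs * B₂ := by
    have hcorr : |ε / 2 * (θ t * logDeriv ω (y t) * sin (2 * φ t / ε))| ≤
        1 * (E / ωs * B₂ * 1) := by
      refine abs_mul_le_mul ?_ (abs_mul_le_mul (abs_mul_le_mul (hθE t ht) (hB₂' _ hyI))
        (abs_sin_le_one _))
      rw [abs_of_nonneg (by linarith [hε.1])]
      linarith [hε.2]
    have hsum : p t = slowVelocity ω ε φ θ y p t -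
        ε / 2 * (θ t * logDeriv ω (y t) * sin (2 * φ t / ε)) := by
      simp [slowVelocity]
    rw [hsum]
    refine (abs_sub _ _).trans ?_
    linarith [hv t ht]
  have hyb : |y t| ≤ |ys| + V * T := by
    have := abs_add_le (y t - ys) ys
    rw [sub_add_cancel] at this
    linarith [hy t ht]
  constructor
  · linarith [hv t ht]
  · linarith [hθE t ht]
  · linarith
  · linarith
  · linarith [hB₁' _ hyI]
  · linarith [hB₂' _ hyI]
  · linarith [hB₃' _ hyI]
  · linarith [hB₄' _ hyI]
  · linarith [hB₅' _ hyI]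

/-- The action is an adiabatic invariant: it drifts by `O(ε)` only. -/
theorem abs_action_sub_le (h : IsActionAngleSolution ω T ε φ θ y p) (hε : ε ∈ Ioc (0 : ℝ) 1)
    (hω : ContDiff ℝ (⊤ : ℕ∞) ω) (hpos : ∀ x, 0 < ω x) (hφ0 : φ 0 = 0) {N : ℝ}
    (hN : ∀ t ∈ Icc 0 T, BoundedBy ω ε φ θ y p N t) :
    ∀ t ∈ Icc 0 T, |θ t - θ 0| ≤ (N ^ 3 + (3 * N ^ 4 + 3 * N ^ 5) * T) * ε := by
  set D : ℝ → ℝ := fun t =>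
    θ t + ε / 2 * (θ t * p t * (logDeriv ω / ω) (y t) * sin (2 * φ t / ε)) with hD
  have hb : ContDiff ℝ (⊤ : ℕ∞) (logDeriv ω / ω) :=
    (contDiff_logDeriv hω hpos).div hω fun x => (hpos x).ne'
  have hε2 : |ε / 2| ≤ ε / 2 := (abs_of_pos (half_pos hε.1)).le
  have hε1 : |ε / 2| ≤ 1 := hε2.trans (by linarith [hε.2])
  have hderiv : ∀ t ∈ Icc 0 T, ∃ D', HasDerivAt D D' t ∧
      |D'| ≤ ε / 2 * (3 * N ^ 4 + 3 * N ^ 5) := by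
    intro t ht
    have hθ := h.hasDerivAt_θ t ht
    have hp := h.hasDerivAt_p t ht
    have hy := h.hasDerivAt_y t ht
    have hby := ((hb.differentiable (by simp)) (y t)).hasDerivAt.comp t hy
    have hDt := hθ.add ((((hθ.mul hp).mul hby).mul (h.hasDerivAt_sin hε.1.ne' ht)).const_mul (ε / 2))
    obtain ⟨Bw, Bθ, -, Bp, Bω', Ba, Ba', Bb, Bb'⟩ := hN t ht
    have hN0 : 0 ≤ N := (abs_nonneg _).trans Bθ
    have Bs : |sin (2 * φ t / ε)| ≤ 1 := abs_sin_le_one _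
    have Bc : |cos (2 * φ t / ε)| ≤ 1 := abs_cos_le_one _
    have hwdef : p t = slowVelocity ω ε φ θ y p t -
        ε / 2 * (θ t * logDeriv ω (y t) * sin (2 * φ t / ε)) := by
      simp [slowVelocity]
    have hab : logDeriv ω (y t) = (logDeriv ω / ω) (y t) * ω (y t) := by
      rw [Pi.div_apply, div_mul_cancel₀ _ (hpos _).ne']
    generalize slowVelocity ω ε φ θ y p t = w at *
    generalize logDeriv ω (y t) = a at *
    generalize deriv (logDeriv ω) (y t) = a' at *
    generalize sin (2 * φ t / ε) = s at *
    generalize cos (2 * φ t / ε) = c at *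
    generalize hb : (logDeriv ω / ω) (y t) = b at *
    generalize deriv (logDeriv ω / ω) (y t) = b' at *
    generalize deriv ω (y t) = ω' at *
    refine ⟨ε / 2 * (-(θ t * θ t * a * a * s * c) - θ t * w * a * c * p t * b * s
      - θ t * θ t * ω' * b * s - ε / 2 * (w * θ t * θ t * a' * b * s * s)
      + θ t * p t * b' * w * s + θ t * p t * b * a * w * s * c), hDt.congr_deriv ?_, ?_⟩
    · have hk : ε / 2 * (2 / ε) = 1 := by
        have := hε.1.ne'
        field_simp
      simp only [Pi.mul_apply, Function.comp_apply, hb]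
      linear_combination θ t * p t * b * c * (ω (y t) + ε / 2 * (a * w * s)) * hk
        - θ t * p t * c * hab + θ t * a * c * hwdef
    · rw [abs_mul]
      refine mul_le_mul hε2 ?_ (abs_nonneg _) (half_pos hε.1).le
      have h1 := abs_mul_le_mul (abs_mul_le_mul (abs_mul_le_mul (abs_mul_le_mul
        (abs_mul_le_mul Bθ Bθ) Ba) Ba) Bs) Bc
      have h2 := abs_mul_le_mul (abs_mul_le_mul (abs_mul_le_mul (abs_mul_le_mul
        (abs_mul_le_mul (abs_mul_le_mul Bθ Bw) Ba) Bc) Bp) Bb) Bs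
      have h3 := abs_mul_le_mul (abs_mul_le_mul (abs_mul_le_mul (abs_mul_le_mul Bθ Bθ) Bω') Bb) Bs
      have h4 := abs_mul_le_mul hε1 (abs_mul_le_mul (abs_mul_le_mul (abs_mul_le_mul
        (abs_mul_le_mul (abs_mul_le_mul (abs_mul_le_mul Bw Bθ) Bθ) Ba') Bb) Bs) Bs)
      have h5 := abs_mul_le_mul (abs_mul_le_mul (abs_mul_le_mul (abs_mul_le_mul Bθ Bp) Bb') Bw) Bs
      have h6 := abs_mul_le_mul (abs_mul_le_mul (abs_mul_le_mul (abs_mul_le_mul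
        (abs_mul_le_mul (abs_mul_le_mul Bθ Bp) Bb) Ba) Bw) Bs) Bc
      rw [abs_le] at h1 h2 h3 h4 h5 h6 ⊢
      constructor <;> linarith
  choose! D' hD' hD'N using hderiv
  intro t ht
  obtain ⟨-, Bθ, -, Bp, -, -, -, Bb, -⟩ := hN t ht
  have hN0 : 0 ≤ N := (abs_nonneg _).trans Bθ
  have hDle := norm_image_sub_le_of_norm_deriv_le_segment'
    (fun s hs => (hD' s hs).hasDerivWithinAt) (fun s hs => hD'N s (Ico_subset_Icc_self hs)) t ht
  have hcorr := abs_mul_le_mul hε2 (abs_mul_le_mul (abs_mul_le_mul (abs_mul_le_mul Bθ Bp) Bb)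
    (abs_sin_le_one (2 * φ t / ε)))
  have hD0 : D 0 = θ 0 := by simp [hD, hφ0]
  have hsum : θ t - θ 0 = (D t - D 0) -
      ε / 2 * (θ t * p t * (logDeriv ω / ω) (y t) * sin (2 * φ t / ε)) := by
    rw [hD0]; simp only [hD]; ring
  rw [hsum]
  refine (abs_sub _ _).trans ((add_le_add hDle hcorr).trans ?_)
  have hT : (3 * N ^ 4 + 3 * N ^ 5) * ε * t ≤ (3 * N ^ 4 + 3 * N ^ 5) * ε * T :=
    mul_le_mul_of_nonneg_left ht.2 (by have := hε.1.le; positivity)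
  have h1 : 0 ≤ (3 * N ^ 4 + 3 * N ^ 5) * ε * t := by
    have := hε.1.le; have := ht.1; positivity
  have h2 : 0 ≤ N ^ 3 * ε := by have := hε.1.le; positivity
  linarith

/-- The solution satisfies the homogenised equations up to `O(ε)`. -/
theorem defect_le (h : IsActionAngleSolution ω T ε φ θ y p) (hε : ε ∈ Ioc (0 : ℝ) 1)
    (hω : ContDiff ℝ (⊤ : ℕ∞) ω) (hpos : ∀ x, 0 < ω x) (hφ0 : φ 0 = 0) {N : ℝ}
    (hN : ∀ t ∈ Icc 0 T, BoundedBy ω ε φ θ y p N t) {t : ℝ} (ht : t ∈ Icc 0 T) :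
    |deriv φ t - ω (y t)| ≤ N ^ 2 * ε ∧ |deriv y t - p t| ≤ N ^ 2 * ε ∧
      |deriv p t + θ 0 * deriv ω (y t)| ≤
        ((N ^ 3 + (3 * N ^ 4 + 3 * N ^ 5) * T) * N + N ^ 3) * ε := by
  have hθ := h.abs_action_sub_le hε hω hpos hφ0 hN t ht
  obtain ⟨Bw, Bθ, -, -, Bω', Ba, Ba', -, -⟩ := hN t ht
  have hε1 : |ε / 2| ≤ ε := by
    rw [abs_of_pos (half_pos hε.1)]; linarith [hε.1]
  have Bs : |sin (2 * φ t / ε)| ≤ 1 := abs_sin_le_one _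
  refine ⟨?_, ?_, ?_⟩
  · rw [(h.hasDerivAt_φ t ht).deriv, add_sub_cancel_left]
    exact (abs_mul_le_mul hε1 (abs_mul_le_mul (abs_mul_le_mul Ba Bw) Bs)).trans_eq (by ring)
  · rw [(h.hasDerivAt_y t ht).deriv, slowVelocity, add_sub_cancel_left]
    exact (abs_mul_le_mul hε1 (abs_mul_le_mul (abs_mul_le_mul Bθ Ba) Bs)).trans_eq (by ring)
  · have hsum : deriv p t + θ 0 * deriv ω (y t) = -((θ t - θ 0) * deriv ω (y t) + ε / 2 *
        (slowVelocity ω ε φ θ y p t * θ t * deriv (logDeriv ω) (y t) * sin (2 * φ t / ε))) := by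
      rw [(h.hasDerivAt_p t ht).deriv]; ring
    rw [hsum, abs_neg]
    refine (abs_add_le _ _).trans ((add_le_add (abs_mul_le_mul hθ Bω') (abs_mul_le_mul hε1
      (abs_mul_le_mul (abs_mul_le_mul (abs_mul_le_mul Bw Bθ) Ba') Bs))).trans_eq ?_)
    ring

end IsActionAngleSolution

/-- Homogenised limit of the action-angle system (Bornemann).
If `(φ_ε, θ_ε, y_ε, p_ε)` solve the action-angle equations on `[0,T]` with
`ε`-independent initial data `φ_ε(0)=0`, `θ_ε(0)=θ_* = u_*²/(2ω(y_*))`,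
`y_ε(0)=y_*`, `p_ε(0)=p_*`, then as `ε → 0⁺`: `y_ε → y₀` in `C¹`, `p_ε → p₀`
in `C¹`, `θ_ε → θ_*` in `C⁰`, `φ_ε → φ₀` in `C¹`, where `φ̇₀ = ω(y₀)`,
`ẏ₀ = p₀`, `ṗ₀ = −θ_*ω'(y₀)`; in particular `ÿ₀ = −θ_*ω'(y₀)`. -/
theorem stmt7 (T : ℝ) (hT : 0 < T)
    (ω : ℝ → ℝ) (hω : ContDiff ℝ (⊤ : ℕ∞) ω)
    (ωs : ℝ) (hωs : 0 < ωs) (hωlb : ∀ x, ωs ≤ ω x)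
    (φ θ y p : ℝ → ℝ → ℝ)
    (hreg : ∀ ε > (0:ℝ), ContDiff ℝ 1 (φ ε) ∧ ContDiff ℝ 1 (θ ε) ∧
      ContDiff ℝ 1 (y ε) ∧ ContDiff ℝ 1 (p ε))
    (ys ps us θs : ℝ) (hθs : θs = us ^ 2 / (2 * ω ys))
    (hinit : ∀ ε > (0:ℝ), φ ε 0 = 0 ∧ θ ε 0 = θs ∧ y ε 0 = ys ∧ p ε 0 = ps)
    (hφode : ∀ ε > (0:ℝ), ∀ t ∈ Icc (0:ℝ) T,
      deriv (φ ε) t = ω (y ε t)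
        + ε * (p ε t * deriv ω (y ε t) / (2 * ω (y ε t))) * Real.sin (2 * φ ε t / ε)
        + ε ^ 2 * (θ ε t * (deriv ω (y ε t)) ^ 2 / (4 * (ω (y ε t)) ^ 2))
            * (Real.sin (2 * φ ε t / ε)) ^ 2)
    (hθode : ∀ ε > (0:ℝ), ∀ t ∈ Icc (0:ℝ) T,
      deriv (θ ε) t
        = -(θ ε t * p ε t * deriv ω (y ε t) / ω (y ε t)) * Real.cos (2 * φ ε t / ε)
          - ε * ((θ ε t) ^ 2 * (deriv ω (y ε t)) ^ 2 / (4 * (ω (y ε t)) ^ 2))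
              * Real.sin (4 * φ ε t / ε))
    (hyode : ∀ ε > (0:ℝ), ∀ t ∈ Icc (0:ℝ) T,
      deriv (y ε) t = p ε t
        + ε * (θ ε t * deriv ω (y ε t) / (2 * ω (y ε t))) * Real.sin (2 * φ ε t / ε))
    (hpode : ∀ ε > (0:ℝ), ∀ t ∈ Icc (0:ℝ) T,
      deriv (p ε) t = -(θ ε t * deriv ω (y ε t))
        + ε * (θ ε t * p ε t * (deriv ω (y ε t)) ^ 2 / (2 * (ω (y ε t)) ^ 2))
            * Real.sin (2 * φ ε t / ε)
        - ε * (θ ε t * p ε t * deriv (deriv ω) (y ε t) / (2 * ω (y ε t)))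
            * Real.sin (2 * φ ε t / ε)
        + ε ^ 2 * ((θ ε t) ^ 2 * (deriv ω (y ε t)) ^ 3 / (4 * (ω (y ε t)) ^ 3))
            * (Real.sin (2 * φ ε t / ε)) ^ 2
        - ε ^ 2 * ((θ ε t) ^ 2 * deriv ω (y ε t) * deriv (deriv ω) (y ε t)
              / (4 * (ω (y ε t)) ^ 2))
            * (Real.sin (2 * φ ε t / ε)) ^ 2) :
    ∃ φ₀ y₀ p₀ : ℝ → ℝ,
      φ₀ 0 = 0 ∧ y₀ 0 = ys ∧ p₀ 0 = ps ∧
      (∀ t ∈ Icc (0:ℝ) T,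
        deriv φ₀ t = ω (y₀ t) ∧ deriv y₀ t = p₀ t ∧
        deriv p₀ t = -(θs * deriv ω (y₀ t)) ∧
        deriv (deriv y₀) t = -(θs * deriv ω (y₀ t))) ∧
      TendstoUniformlyOn (fun ε t => y ε t) y₀ (𝓝[>] (0:ℝ)) (Icc 0 T) ∧
      TendstoUniformlyOn (fun ε t => deriv (y ε) t) (deriv y₀) (𝓝[>] (0:ℝ)) (Icc 0 T) ∧
      TendstoUniformlyOn (fun ε t => p ε t) p₀ (𝓝[>] (0:ℝ)) (Icc 0 T) ∧
      TendstoUniformlyOn (fun ε t => deriv (p ε) t) (deriv p₀) (𝓝[>] (0:ℝ)) (Icc 0 T) ∧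
      TendstoUniformlyOn (fun ε t => θ ε t) (fun _ => θs) (𝓝[>] (0:ℝ)) (Icc 0 T) ∧
      TendstoUniformlyOn (fun ε t => φ ε t) φ₀ (𝓝[>] (0:ℝ)) (Icc 0 T) ∧
      TendstoUniformlyOn (fun ε t => deriv (φ ε) t) (deriv φ₀) (𝓝[>] (0:ℝ)) (Icc 0 T) := by
  have hpos : ∀ x, 0 < ω x := fun x => hωs.trans_le (hωlb x)
  have hω1 : ContDiff ℝ 1 ω := hω.of_le (by exact_mod_cast le_top)
  have hdω : ContDiff ℝ (⊤ : ℕ∞) (deriv ω) := (contDiff_infty_iff_deriv.1 hω).2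
  have hdω1 : ContDiff ℝ 1 (deriv ω) := hdω.of_le (by exact_mod_cast le_top)
  have hθs0 : 0 ≤ θs := by
    have := (hpos ys).le
    rw [hθs]; positivity
  have hsol : ∀ ε > (0 : ℝ), IsActionAngleSolution ω T ε (φ ε) (θ ε) (y ε) (p ε) := by
    intro ε hε
    obtain ⟨hφ, hθ, hy, hp⟩ := hreg ε hε
    have hd {f : ℝ → ℝ} (hf : ContDiff ℝ 1 f) (t : ℝ) : HasDerivAt f (deriv f t) t :=
      (hf.differentiable one_ne_zero t).hasDerivAt
    refine ⟨hφ.continuous, hθ.continuous, hy.continuous, hp.continuous, fun t ht => ?_,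
      fun t ht => ?_, fun t ht => ?_, fun t ht => ?_⟩
    · refine (hd hφ t).congr_deriv ?_
      rw [hφode ε hε t ht, slowVelocity, logDeriv_apply]
      have := (hpos (y ε t)).ne'
      field_simp
      ring
    · refine (hd hθ t).congr_deriv ?_
      rw [hθode ε hε t ht, slowVelocity, logDeriv_apply,
        show 4 * φ ε t / ε = 2 * (2 * φ ε t / ε) by ring, Real.sin_two_mul]
      have := (hpos (y ε t)).ne'
      field_simp
      ring
    · refine (hd hy t).congr_deriv ?_
      rw [hyode ε hε t ht, slowVelocity, logDeriv_apply]
      ring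
    · refine (hd hp t).congr_deriv ?_
      have hdd : deriv (logDeriv ω) (y ε t) =
          deriv (deriv ω) (y ε t) / ω (y ε t) - deriv ω (y ε t) ^ 2 / ω (y ε t) ^ 2 := by
        have := (hpos (y ε t)).ne'
        rw [logDeriv, deriv_div (hdω1.differentiable one_ne_zero _)
          (hω1.differentiable one_ne_zero _) this]
        field_simp
      rw [hpode ε hε t ht, slowVelocity, hdd, logDeriv_apply]
      have := (hpos (y ε t)).ne'
      field_simp
      ring
  obtain ⟨N, hN⟩ := IsActionAngleSolution.exists_boundedBy hω hωs hωlb hθs0 ys ps hT.le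
  have hbd : ∀ ε ∈ Ioc (0 : ℝ) 1, ∀ t ∈ Icc 0 T,
      IsActionAngleSolution.BoundedBy ω ε (φ ε) (θ ε) (y ε) (p ε) N t := fun ε hε =>
    have ⟨h1, h2, h3, h4⟩ := hinit ε hε.1
    hN ε hε _ _ _ _ (hsol ε hε.1) h1 h2 h3 h4
  have hone : (1 : ℝ) ∈ Ioc (0 : ℝ) 1 := ⟨one_pos, le_rfl⟩
  have hN0 : 0 ≤ N := (abs_nonneg _).trans (hbd 1 hone 0 ⟨le_rfl, hT.le⟩).action
  have hR : -(N + 1) ≤ N + 1 := by linarith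
  let clamp : ℝ → ℝ := fun x => projIcc (-(N + 1)) (N + 1) hR x
  have hclamp : ∀ x, |x| < N + 1 → clamp x = x := fun x hx => by
    have := abs_lt.1 hx
    exact congrArg Subtype.val (projIcc_of_mem hR ⟨this.1.le, this.2.le⟩)
  obtain ⟨K₁, C₁, hK₁, hC₁⟩ := hω1.exists_lipschitzWith_comp_projIcc hR
  obtain ⟨K₂, C₂, hK₂, hC₂⟩ := (contDiff_id (n := 1) (𝕜 := ℝ)).exists_lipschitzWith_comp_projIcc hR
  obtain ⟨K₃, C₃, hK₃, hC₃⟩ :=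
    (contDiff_const (c := -θs)).mul hdω1 |>.exists_lipschitzWith_comp_projIcc hR
  let F : ℝ × ℝ × ℝ → ℝ × ℝ × ℝ :=
    fun x => (ω (clamp x.2.1), clamp x.2.2, -θs * deriv ω (clamp x.2.1))
  have hfst : LipschitzWith 1 fun x : ℝ × ℝ × ℝ => x.2.1 :=
    (LipschitzWith.prod_fst.comp LipschitzWith.prod_snd).weaken (by simp)
  have hsnd : LipschitzWith 1 fun x : ℝ × ℝ × ℝ => x.2.2 :=
    (LipschitzWith.prod_snd.comp LipschitzWith.prod_snd).weaken (by simp)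
  have hF := (hK₁.comp hfst).prodMk ((hK₂.comp hsnd).prodMk (hK₃.comp hfst))
  change LipschitzWith _ F at hF
  have hFb : ∀ x, ‖F x‖ ≤ max C₁ (max C₂ C₃) := fun x =>
    max_le_max (hC₁ _) (max_le_max (hC₂ _) (hC₃ _))
  obtain ⟨α, hα0, hα⟩ := exists_integralCurve_of_bounded_lipschitz hF hFb (0, ys, ps) hT.le
  have hIoo : ∀ t ∈ Icc 0 T, t ∈ Ioo (-1) (T + 1) := fun t ht =>
    ⟨by linarith [ht.1], by linarith [ht.2]⟩
  have hFX : ∀ ε ∈ Ioc (0 : ℝ) 1, ∀ t ∈ Icc 0 T, F (φ ε t, y ε t, p ε t) =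
      (ω (y ε t), p ε t, -θs * deriv ω (y ε t)) := by
    intro ε hε t ht
    have h1 := hclamp (y ε t) (by linarith [(hbd ε hε t ht).position])
    have h2 := hclamp (p ε t) (by linarith [(hbd ε hε t ht).momentum])
    simp only [F, h1, h2]
  set C := max (N ^ 2) (max (N ^ 2) ((N ^ 3 + (3 * N ^ 4 + 3 * N ^ 5) * T) * N + N ^ 3))
  obtain ⟨hX, hX'⟩ := tendstoUniformlyOn_of_approx_integralCurve hF (C := C)
    (fun t ht => hα t (hIoo t ht)) (X := fun ε t => (φ ε t, y ε t, p ε t))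
    (X' := fun ε t => (deriv (φ ε) t, deriv (y ε) t, deriv (p ε) t))
    (fun ε hε t ht => by
      have h := hsol ε hε.1
      exact (h.hasDerivAt_φ t ht).differentiableAt.hasDerivAt.prodMk
        ((h.hasDerivAt_y t ht).differentiableAt.hasDerivAt.prodMk
          (h.hasDerivAt_p t ht).differentiableAt.hasDerivAt))
    (fun ε hε t ht => by
      obtain ⟨h1, h2, h3⟩ := (hsol ε hε.1).defect_le hε hω hpos (hinit ε hε.1).1 (hbd ε hε) ht
      have hε0 := hε.1.le
      rw [hFX ε hε t ht]
      refine max_le (h1.trans ?_) (max_le (h2.trans ?_) (Eq.trans_le ?_ (h3.trans ?_)))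
      · gcongr; exact le_max_left _ _
      · gcongr; exact (le_max_left _ _).trans (le_max_right _ _)
      · rw [(hinit ε hε.1).2.1]
        change |deriv (p ε) t - -θs * deriv ω (y ε t)| = _
        congr 1; ring
      · gcongr; exact (le_max_right _ _).trans (le_max_right _ _))
    (fun ε hε => by
      obtain ⟨h1, -, h3, h4⟩ := hinit ε hε.1
      simp only [h1, h3, h4, hα0])
  have hsmall : ∀ᶠ ε : ℝ in 𝓝[>] 0, ε ∈ Ioc (0 : ℝ) 1 := Ioc_mem_nhdsGT one_pos
  have hXφ := LipschitzWith.prod_fst.uniformContinuous.comp_tendstoUniformlyOn hX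
  have hXy := hfst.uniformContinuous.comp_tendstoUniformlyOn hX
  have hXp := hsnd.uniformContinuous.comp_tendstoUniformlyOn hX
  have hXφ' := LipschitzWith.prod_fst.uniformContinuous.comp_tendstoUniformlyOn hX'
  have hXy' := hfst.uniformContinuous.comp_tendstoUniformlyOn hX'
  have hXp' := hsnd.uniformContinuous.comp_tendstoUniformlyOn hX'
  have hα1 : ∀ t ∈ Icc 0 T, |(α t).2.1| ≤ N := fun t ht =>
    le_of_tendsto (hXy.tendsto_at ht).abs
      (hsmall.mono fun ε hε => (hbd ε hε t ht).position)
  have hα2 : ∀ t ∈ Icc 0 T, |(α t).2.2| ≤ N := fun t ht =>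
    le_of_tendsto (hXp.tendsto_at ht).abs
      (hsmall.mono fun ε hε => (hbd ε hε t ht).momentum)
  have hdφ : ∀ t ∈ Ioo (-1) (T + 1), HasDerivAt (fun t => (α t).1) (F (α t)).1 t :=
    fun t ht => (hα t ht).fst
  have hdy : ∀ t ∈ Ioo (-1) (T + 1), HasDerivAt (fun t => (α t).2.1) (F (α t)).2.1 t :=
    fun t ht => (hα t ht).snd.fst
  have hdp : ∀ t ∈ Ioo (-1) (T + 1), HasDerivAt (fun t => (α t).2.2) (F (α t)).2.2 t :=
    fun t ht => (hα t ht).snd.snd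
  have hcy : ∀ t ∈ Icc 0 T, clamp (α t).2.1 = (α t).2.1 := fun t ht =>
    hclamp _ (by linarith [hα1 t ht])
  have hcp : ∀ t ∈ Icc 0 T, clamp (α t).2.2 = (α t).2.2 := fun t ht =>
    hclamp _ (by linarith [hα2 t ht])
  have hdp0 : ∀ t ∈ Icc 0 T,
      HasDerivAt (fun t => (α t).2.2) (-(θs * deriv ω (α t).2.1)) t := fun t ht =>
    (hdp t (hIoo t ht)).congr_deriv (by simp only [F, hcy t ht]; ring)
  refine ⟨fun t => (α t).1, fun t => (α t).2.1, fun t => (α t).2.2, by simp [hα0], by simp [hα0],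
    by simp [hα0], fun t ht => ⟨?_, ?_, (hdp0 t ht).deriv, ?_⟩, hXy, ?_, hXp, ?_, ?_, hXφ, ?_⟩
  · rw [(hdφ t (hIoo t ht)).deriv]; simp only [F, hcy t ht]
  · rw [(hdy t (hIoo t ht)).deriv]; simp only [F, hcp t ht]
  · have hev : deriv (fun t => (α t).2.1) =ᶠ[𝓝 t] fun t => (α t).2.2 := by
      have hcont := (hdp0 t ht).continuousAt.abs
      filter_upwards [Ioo_mem_nhds (hIoo t ht).1 (hIoo t ht).2,
        hcont.eventually_lt_const (by linarith [hα2 t ht] : |(α t).2.2| < N + 1)] with s hs hlt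
      rw [(hdy s hs).deriv]
      exact hclamp _ hlt
    rw [hev.deriv_eq, (hdp0 t ht).deriv]
  · exact hXy'.congr_right fun t ht => ((hdy t (hIoo t ht)).deriv).symm
  · exact hXp'.congr_right fun t ht => ((hdp t (hIoo t ht)).deriv).symm
  · rw [Metric.tendstoUniformlyOn_iff]
    intro η hη
    have hlim : Tendsto (fun ε : ℝ => (N ^ 3 + (3 * N ^ 4 + 3 * N ^ 5) * T) * ε) (𝓝[>] 0) (𝓝 0) :=
      (Continuous.tendsto' (by fun_prop) 0 0 (by simp)).mono_left nhdsWithin_le_nhds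
    filter_upwards [hsmall, hlim.eventually_lt_const hη] with ε hε hlt t ht
    have := (hsol ε hε.1).abs_action_sub_le hε hω hpos (hinit ε hε.1).1 (hbd ε hε) t ht
    rw [(hinit ε hε.1).2.1] at this
    rw [dist_comm, Real.dist_eq]
    exact this.trans_lt hlt
  · exact hXφ'.congr_right fun t ht => ((hdφ t (hIoo t ht)).deriv).symm
end

section
/- With notation as in the homogenisation theorem, the first-order correction of the action variable satisfies θ_ε − θ_* = ε[θ₁]^ε + O(ε²) uniformly on [0,T], where [θ₁]^ε(t) = −(θ_* (d/dt log ω(y₀(t)))/(2ω(y₀(t)))) sin(2φ₀(t)/ε). In particular ε⁻¹(θ_ε − θ_*) converges weakly* to 0 in L^∞((0,T)). -/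
open Real Set Filter Topology MeasureTheory

open Asymptotics

/-- The filter on pairs `(ε, t)` describing `ε → 0⁺`, uniformly in `t ∈ [0, T]`. -/
def slab (T : ℝ) : Filter (ℝ × ℝ) := 𝓝[>] (0 : ℝ) ×ˢ 𝓟 (Icc 0 T)

/-- `D` is the derivative of `X` in its second variable (time), for all small `ε`. -/
def HasTimeDeriv {E : Type*} [NormedAddCommGroup E] [NormedSpace ℝ E] (T : ℝ)
    (X D : ℝ × ℝ → E) : Prop :=
  ∀ᶠ x in slab T, HasDerivAt (fun t => X (x.1, t)) (D x) x.2

/-- A uniformly bounded family of functions of time with uniformly bounded derivative. -/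
structure IsSlow (T : ℝ) (F : ℝ × ℝ → ℝ) : Prop where
  bdd : F =O[slab T] (fun _ => (1 : ℝ))
  exists_deriv : ∃ D, HasTimeDeriv T F D ∧ D =O[slab T] (fun _ => (1 : ℝ))

/-- Up to an error `O(ε)`, the family `G` is the time derivative of a family of size `O(ε)`. -/
def Averages (T : ℝ) (G : ℝ × ℝ → ℝ) : Prop :=
  ∃ R D : ℝ × ℝ → ℝ, R =O[slab T] (fun x => x.1) ∧ HasTimeDeriv T R D ∧
    (fun x => D x - G x) =O[slab T] (fun x => x.1)

section Slab

variable {T : ℝ}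

lemma eventually_slab {P : ℝ × ℝ → Prop} :
    (∀ᶠ x in slab T, P x) ↔ ∀ᶠ ε in 𝓝[>] (0 : ℝ), ∀ t ∈ Icc (0 : ℝ) T, P (ε, t) := by
  simp only [slab, eventually_prod_principal_iff]

lemma eventually_slab_pos : ∀ᶠ x in slab T, 0 < x.1 ∧ x.2 ∈ Icc (0 : ℝ) T := by
  rw [eventually_slab]
  filter_upwards [self_mem_nhdsWithin] with ε hε t ht using ⟨hε, ht⟩

lemma tendsto_slab_at {t : ℝ} (ht : t ∈ Icc (0 : ℝ) T) :
    Tendsto (fun ε : ℝ => (ε, t)) (𝓝[>] (0 : ℝ)) (slab T) :=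
  tendsto_id.prodMk (tendsto_principal.2 (.of_forall fun _ => ht))

lemma isBigO_fst_one : (fun x : ℝ × ℝ => x.1) =O[slab T] (fun _ => (1 : ℝ)) := by
  refine IsBigO.of_bound 1 (eventually_slab.2 ?_)
  filter_upwards [Ioo_mem_nhdsGT (zero_lt_one' ℝ)] with ε hε t _
  simpa [abs_of_pos hε.1] using hε.2.le

lemma isBigO_fst_sq_fst : (fun x : ℝ × ℝ => x.1 ^ 2) =O[slab T] (fun x => x.1) := by
  simpa [pow_two] using (isBigO_refl (fun x : ℝ × ℝ => x.1) (slab T)).mul isBigO_fst_one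

lemma Asymptotics.IsBigO.mul_bdd {k : ℝ × ℝ → ℝ} {F G : ℝ × ℝ → ℝ} (hF : F =O[slab T] k)
    (hG : G =O[slab T] (fun _ => (1 : ℝ))) : (fun x => F x * G x) =O[slab T] k := by
  simpa using hF.mul hG

lemma Asymptotics.IsBigO.fst_mul {F : ℝ × ℝ → ℝ} (hF : F =O[slab T] (fun _ => (1 : ℝ))) :
    (fun x => x.1 * F x) =O[slab T] (fun x => x.1) :=
  (isBigO_refl _ _).mul_bdd hF

lemma Asymptotics.IsBigO.fst_mul_sq {F : ℝ × ℝ → ℝ} (hF : F =O[slab T] (fun x => x.1)) :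
    (fun x => x.1 * F x) =O[slab T] (fun x => x.1 ^ 2) := by
  simpa [pow_two] using (isBigO_refl (fun x : ℝ × ℝ => x.1) (slab T)).mul hF

lemma isBigO_one_of_abs_le {F : ℝ × ℝ → ℝ} (C : ℝ) (h : ∀ x, |F x| ≤ C) :
    F =O[slab T] (fun _ => (1 : ℝ)) :=
  .of_bound C (.of_forall fun x => by simpa using h x)

lemma isBigO_sin (a : ℝ × ℝ → ℝ) : (fun x => sin (a x)) =O[slab T] (fun _ => (1 : ℝ)) :=
  isBigO_one_of_abs_le 1 fun _ => abs_sin_le_one _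

lemma isBigO_cos (a : ℝ × ℝ → ℝ) : (fun x => cos (a x)) =O[slab T] (fun _ => (1 : ℝ)) :=
  isBigO_one_of_abs_le 1 fun _ => abs_cos_le_one _

lemma isBigO_one_of_continuousOn {f : ℝ → ℝ} (hf : ContinuousOn f (Icc 0 T)) :
    (fun x : ℝ × ℝ => f x.2) =O[slab T] (fun _ => (1 : ℝ)) := by
  obtain ⟨C, hC⟩ := isCompact_Icc.exists_bound_of_continuousOn hf
  refine .of_bound C ?_
  filter_upwards [eventually_slab_pos] with x hx
  simpa using hC _ hx.2

lemma isBigO_comp_of_continuous {h : ℝ → ℝ} (hh : Continuous h) {y : ℝ × ℝ → ℝ}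
    (hy : y =O[slab T] (fun _ => (1 : ℝ))) : (fun x => h (y x)) =O[slab T] (fun _ => (1 : ℝ)) := by
  obtain ⟨M, hM⟩ := hy.bound
  obtain ⟨C, hC⟩ := isCompact_Icc.exists_bound_of_continuousOn (hh.continuousOn (s := Icc (-M) M))
  refine .of_bound C ?_
  filter_upwards [hM] with x hx
  simpa using hC _ (abs_le.1 (by simpa using hx))

lemma isBigO_comp_sub_comp {h : ℝ → ℝ} (hh : ContDiff ℝ (⊤ : ℕ∞) h) {y z : ℝ × ℝ → ℝ}
    (hy : y =O[slab T] (fun _ => (1 : ℝ))) (hz : z =O[slab T] (fun _ => (1 : ℝ))) :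
    (fun x => h (y x) - h (z x)) =O[slab T] (fun x => y x - z x) := by
  obtain ⟨M, hM⟩ := hy.bound
  obtain ⟨N, hN⟩ := hz.bound
  obtain ⟨C, hC⟩ := isCompact_Icc.exists_bound_of_continuousOn
    ((hh.continuous_deriv (by simp)).continuousOn (s := Icc (-max M N) (max M N)))
  refine .of_bound C ?_
  filter_upwards [hM, hN] with x hx hx'
  refine (convex_Icc (-max M N) (max M N)).norm_image_sub_le_of_norm_hasDerivWithin_le
    (fun u _ => (hh.differentiable (by simp) u).hasDerivAt.hasDerivWithinAt) hC ?_ ?_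
  · exact abs_le.1 ((show |z x| ≤ N by simpa using hx').trans (le_max_right _ _))
  · exact abs_le.1 ((show |y x| ≤ M by simpa using hx).trans (le_max_left _ _))

lemma HasTimeDeriv.add {E : Type*} [NormedAddCommGroup E] [NormedSpace ℝ E]
    {X Y DX DY : ℝ × ℝ → E} (hX : HasTimeDeriv T X DX) (hY : HasTimeDeriv T Y DY) :
    HasTimeDeriv T (fun x => X x + Y x) (fun x => DX x + DY x) := by
  filter_upwards [hX, hY] with x h1 h2 using h1.add h2

lemma HasTimeDeriv.sub {E : Type*} [NormedAddCommGroup E] [NormedSpace ℝ E]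
    {X Y DX DY : ℝ × ℝ → E} (hX : HasTimeDeriv T X DX) (hY : HasTimeDeriv T Y DY) :
    HasTimeDeriv T (fun x => X x - Y x) (fun x => DX x - DY x) := by
  filter_upwards [hX, hY] with x h1 h2 using h1.sub h2

lemma HasTimeDeriv.mul {X Y DX DY : ℝ × ℝ → ℝ} (hX : HasTimeDeriv T X DX)
    (hY : HasTimeDeriv T Y DY) :
    HasTimeDeriv T (fun x => X x * Y x) (fun x => DX x * Y x + X x * DY x) := by
  filter_upwards [hX, hY] with x h1 h2 using h1.mul h2

lemma HasTimeDeriv.fst_mul {X D : ℝ × ℝ → ℝ} (hX : HasTimeDeriv T X D) :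
    HasTimeDeriv T (fun x => x.1 * X x) (fun x => x.1 * D x) := by
  filter_upwards [hX] with x h using h.const_mul x.1

lemma HasTimeDeriv.comp {h : ℝ → ℝ} (hh : ContDiff ℝ (⊤ : ℕ∞) h) {X D : ℝ × ℝ → ℝ}
    (hX : HasTimeDeriv T X D) :
    HasTimeDeriv T (fun x => h (X x)) (fun x => deriv h (X x) * D x) := by
  filter_upwards [hX] with x hx
  exact (hh.differentiable (by simp) (X x)).hasDerivAt.comp x.2 hx

lemma HasTimeDeriv.congr {E : Type*} [NormedAddCommGroup E] [NormedSpace ℝ E]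
    {X D D' : ℝ × ℝ → E} (hX : HasTimeDeriv T X D) (h : D =ᶠ[slab T] D') :
    HasTimeDeriv T X D' := by
  filter_upwards [hX, h] with x h1 h2 using h2 ▸ h1

lemma HasTimeDeriv.prodMk {X Y DX DY : ℝ × ℝ → ℝ} (hX : HasTimeDeriv T X DX)
    (hY : HasTimeDeriv T Y DY) :
    HasTimeDeriv T (fun x => (X x, Y x)) (fun x => (DX x, DY x)) := by
  filter_upwards [hX, hY] with x h1 h2 using h1.prodMk h2

lemma hasTimeDeriv_const (c : ℝ) : HasTimeDeriv T (fun _ => c) (fun _ => 0) :=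
  .of_forall fun _ => hasDerivAt_const _ _

lemma IsSlow.add {F G : ℝ × ℝ → ℝ} (hF : IsSlow T F) (hG : IsSlow T G) :
    IsSlow T (fun x => F x + G x) := by
  obtain ⟨D, h1, h2⟩ := hF.exists_deriv
  obtain ⟨D', h3, h4⟩ := hG.exists_deriv
  exact ⟨hF.bdd.add hG.bdd, _, h1.add h3, h2.add h4⟩

lemma IsSlow.mul {F G : ℝ × ℝ → ℝ} (hF : IsSlow T F) (hG : IsSlow T G) :
    IsSlow T (fun x => F x * G x) := by
  obtain ⟨D, h1, h2⟩ := hF.exists_deriv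
  obtain ⟨D', h3, h4⟩ := hG.exists_deriv
  exact ⟨hF.bdd.mul_bdd hG.bdd, _, h1.mul h3, (h2.mul_bdd hG.bdd).add (hF.bdd.mul_bdd h4)⟩

lemma isSlow_const (c : ℝ) : IsSlow T (fun _ => c) :=
  ⟨isBigO_const_const _ one_ne_zero _, _, hasTimeDeriv_const c, isBigO_zero _ _⟩

lemma IsSlow.comp {h : ℝ → ℝ} (hh : ContDiff ℝ (⊤ : ℕ∞) h) {F : ℝ × ℝ → ℝ} (hF : IsSlow T F) :
    IsSlow T (fun x => h (F x)) := by
  obtain ⟨D, h1, h2⟩ := hF.exists_deriv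
  exact ⟨isBigO_comp_of_continuous hh.continuous hF.bdd, _, h1.comp hh,
    (isBigO_comp_of_continuous (hh.continuous_deriv (by simp)) hF.bdd).mul_bdd h2⟩

lemma isSlow_of_contDiff {g : ℝ → ℝ} (hg : ContDiff ℝ 1 g) : IsSlow T (fun x => g x.2) :=
  ⟨isBigO_one_of_continuousOn hg.continuous.continuousOn, fun x => deriv g x.2,
    .of_forall fun x => (hg.differentiable (by simp) x.2).hasDerivAt,
    isBigO_one_of_continuousOn (hg.continuous_deriv (by simp)).continuousOn⟩

lemma Averages.add {F G : ℝ × ℝ → ℝ} (hF : Averages T F) (hG : Averages T G) :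
    Averages T (fun x => F x + G x) := by
  obtain ⟨R, D, h1, h2, h3⟩ := hF
  obtain ⟨R', D', h1', h2', h3'⟩ := hG
  exact ⟨_, _, h1.add h1', h2.add h2', (h3.add h3').congr_left fun x => by ring⟩

/-- Grönwall's inequality for families with initial value and forcing of size `O(ε²)`. -/
lemma isBigO_sq_of_gronwall {E : Type*} [NormedAddCommGroup E] [NormedSpace ℝ E]
    {X D : ℝ × ℝ → E} (hX : HasTimeDeriv T X D)
    (hD : D =O[slab T] (fun x => ‖X x‖ + x.1 ^ 2))
    (h0 : (fun ε : ℝ => X (ε, 0)) =O[𝓝[>] (0 : ℝ)] (fun ε => ε ^ 2)) :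
    X =O[slab T] (fun x => x.1 ^ 2) := by
  obtain ⟨K, hK, hDb⟩ := hD.exists_pos
  obtain ⟨C, hC, h0b⟩ := h0.exists_pos
  have hDb := eventually_slab.1 hDb.bound
  refine .of_bound (gronwallBound C K K T) (eventually_slab.2 ?_)
  filter_upwards [hDb, h0b.bound, eventually_slab.1 hX, self_mem_nhdsWithin]
    with ε h1 h2 h3 hε t ht
  have hε : 0 < ε := hε
  have key := norm_le_gronwallBound_of_norm_deriv_right_le (f := fun t => X (ε, t))
    (f' := fun t => D (ε, t)) (δ := C * ε ^ 2) (K := K) (ε := K * ε ^ 2) (a := 0) (b := T)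
    (fun t ht => (h3 t ht).continuousAt.continuousWithinAt)
    (fun t ht => (h3 t (Ico_subset_Icc_self ht)).hasDerivWithinAt)
    (by simpa using h2)
    (fun t ht => by
      have h := h1 t (Ico_subset_Icc_self ht)
      rw [Real.norm_of_nonneg (by positivity)] at h
      linarith) t ht
  refine key.trans ((gronwallBound_mono (by positivity) (by positivity) hK.le
    (by simpa using ht.2)).trans (le_of_eq ?_))
  rw [gronwallBound_of_K_ne_0 hK.ne', gronwallBound_of_K_ne_0 hK.ne',
    Real.norm_of_nonneg (by positivity)]
  ring

/-- First-order averaging: a forcing `ε G` with `G` averaging out has an effect of size `O(ε²)`. -/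
lemma isBigO_sq_of_averages (hT : 0 ≤ T) {X D G : ℝ × ℝ → ℝ} (hX : HasTimeDeriv T X D)
    (hG : Averages T G) (hD : (fun x => D x - x.1 * G x) =O[slab T] (fun x => x.1 ^ 2))
    (h0 : ∀ᶠ ε in 𝓝[>] (0 : ℝ), X (ε, 0) = 0) : X =O[slab T] (fun x => x.1 ^ 2) := by
  obtain ⟨R, DR, hR, hDR, hRG⟩ := hG
  have hεR := hR.fst_mul_sq
  have key : (fun x => X x - x.1 * R x) =O[slab T] (fun x => x.1 ^ 2) := by
    refine isBigO_sq_of_gronwall (hX.sub hDR.fst_mul) ?_ ?_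
    · refine ((hD.sub hRG.fst_mul_sq).congr_left fun x => by ring).trans ?_
      refine .of_bound 1 (.of_forall fun x => ?_)
      rw [Real.norm_of_nonneg (by positivity), Real.norm_of_nonneg (by positivity)]
      linarith [norm_nonneg (X x - x.1 * R x)]
    · have h0' : (fun ε : ℝ => X (ε, 0)) =O[𝓝[>] (0 : ℝ)] (fun ε => ε ^ 2) :=
        (isBigO_zero _ _).congr' (h0.mono fun ε h => h.symm) .rfl
      exact h0'.sub (hεR.comp_tendsto (tendsto_slab_at ⟨le_rfl, hT⟩))
  simpa using key.add hεR

end Slab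

/-- The action-angle system, written with the velocity `q = ẏ` in place of the canonical
momentum, for families bounded uniformly on `[0, T]`, together with its homogenised limit. -/
structure ActionAngleSystem (T : ℝ) (ω : ℝ → ℝ) (θs : ℝ) (φ θ y q : ℝ × ℝ → ℝ)
    (φ₀ y₀ p₀ : ℝ → ℝ) : Prop where
  T_nonneg : 0 ≤ T
  smooth : ContDiff ℝ (⊤ : ℕ∞) ω
  pos : ∀ u, 0 < ω u
  bdd_θ : θ =O[slab T] (fun _ => (1 : ℝ))
  bdd_y : y =O[slab T] (fun _ => (1 : ℝ))
  bdd_q : q =O[slab T] (fun _ => (1 : ℝ))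
  deriv_φ : HasTimeDeriv T φ (fun x => ω (y x) +
    x.1 * (q x * deriv ω (y x) / (2 * ω (y x))) * sin (2 * φ x / x.1))
  deriv_θ : HasTimeDeriv T θ (fun x =>
    -(q x * θ x * deriv ω (y x) / ω (y x)) * cos (2 * φ x / x.1))
  deriv_y : HasTimeDeriv T y q
  deriv_q : HasTimeDeriv T q (fun x =>
    -(θ x * deriv ω (y x)) + θ x * deriv ω (y x) * cos (2 * φ x / x.1))
  initial : ∀ᶠ ε in 𝓝[>] (0 : ℝ),
    φ (ε, 0) = φ₀ 0 ∧ θ (ε, 0) = θs ∧ y (ε, 0) = y₀ 0 ∧ q (ε, 0) = p₀ 0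
  init_φ₀ : φ₀ 0 = 0
  deriv_φ₀ : ∀ t ∈ Icc 0 T, HasDerivAt φ₀ (ω (y₀ t)) t
  deriv_y₀ : ∀ t ∈ Icc 0 T, HasDerivAt y₀ (p₀ t) t
  deriv_p₀ : ∀ t ∈ Icc 0 T, HasDerivAt p₀ (-(θs * deriv ω (y₀ t))) t

namespace ActionAngleSystem

variable {T : ℝ} {ω : ℝ → ℝ} {θs : ℝ} {φ θ y q : ℝ × ℝ → ℝ} {φ₀ y₀ p₀ : ℝ → ℝ}

lemma smooth_deriv (S : ActionAngleSystem T ω θs φ θ y q φ₀ y₀ p₀) :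
    ContDiff ℝ (⊤ : ℕ∞) (deriv ω) := (contDiff_infty_iff_deriv.1 S.smooth).2

lemma bdd_deriv_ω (S : ActionAngleSystem T ω θs φ θ y q φ₀ y₀ p₀) :
    (fun x => deriv ω (y x)) =O[slab T] (fun _ => (1 : ℝ)) :=
  isBigO_comp_of_continuous S.smooth_deriv.continuous S.bdd_y

lemma smooth_rate (S : ActionAngleSystem T ω θs φ θ y q φ₀ y₀ p₀) :
    ContDiff ℝ (⊤ : ℕ∞) (fun u => deriv ω u / (2 * ω u)) :=
  S.smooth_deriv.div (contDiff_const.mul S.smooth) fun u => by have := S.pos u; positivity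

lemma smooth_coeff (S : ActionAngleSystem T ω θs φ θ y q φ₀ y₀ p₀) :
    ContDiff ℝ (⊤ : ℕ∞) (fun u => deriv ω u / (2 * ω u ^ 2)) :=
  S.smooth_deriv.div (contDiff_const.mul (S.smooth.pow 2)) fun u => by have := S.pos u; positivity

lemma smooth_inv (S : ActionAngleSystem T ω θs φ θ y q φ₀ y₀ p₀) :
    ContDiff ℝ (⊤ : ℕ∞) (fun u => (2 * ω u)⁻¹) :=
  (contDiff_const.mul S.smooth).inv fun u => by have := S.pos u; positivity

lemma bdd_rate (S : ActionAngleSystem T ω θs φ θ y q φ₀ y₀ p₀) :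
    (fun x => q x * deriv ω (y x) / (2 * ω (y x))) =O[slab T] (fun _ => (1 : ℝ)) :=
  (S.bdd_q.mul_bdd (isBigO_comp_of_continuous S.smooth_rate.continuous S.bdd_y)).congr_left
    fun x => by ring

lemma slow_y (S : ActionAngleSystem T ω θs φ θ y q φ₀ y₀ p₀) :
    IsSlow T y := ⟨S.bdd_y, q, S.deriv_y, S.bdd_q⟩

lemma slow_q (S : ActionAngleSystem T ω θs φ θ y q φ₀ y₀ p₀) :
    IsSlow T q :=
  ⟨S.bdd_q, _, S.deriv_q, (S.bdd_θ.mul_bdd S.bdd_deriv_ω).neg_left.add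
    ((S.bdd_θ.mul_bdd S.bdd_deriv_ω).mul_bdd (isBigO_cos _))⟩

lemma slow_θ (S : ActionAngleSystem T ω θs φ θ y q φ₀ y₀ p₀) :
    IsSlow T θ := by
  refine ⟨S.bdd_θ, _, S.deriv_θ, IsBigO.mul_bdd ?_
    (isBigO_cos _)⟩
  refine ((S.bdd_rate.mul_bdd S.bdd_θ).const_mul_left (-2)).congr_left fun x => ?_
  have := S.pos (y x)
  field_simp

lemma deriv_osc (S : ActionAngleSystem T ω θs φ θ y q φ₀ y₀ p₀)
    {Ψ ψ : ℝ → ℝ} (hΨ : ∀ u, HasDerivAt Ψ (ψ u) u) :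
    HasTimeDeriv T (fun x => x.1 * Ψ (2 * φ x / x.1)) (fun x => ψ (2 * φ x / x.1) *
      (2 * (ω (y x) + x.1 * (q x * deriv ω (y x) / (2 * ω (y x))) * sin (2 * φ x / x.1)))) := by
  filter_upwards [S.deriv_φ, eventually_slab_pos] with x hx hpos
  have h := ((hΨ (2 * φ x / x.1)).comp x.2 ((hx.const_mul 2).div_const x.1)).const_mul x.1
  refine h.congr_deriv ?_
  have := hpos.1.ne'
  field_simp

lemma averages_osc (S : ActionAngleSystem T ω θs φ θ y q φ₀ y₀ p₀)
    {F : ℝ × ℝ → ℝ} (hF : IsSlow T F) {Ψ ψ : ℝ → ℝ} {C : ℝ}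
    (hΨ : ∀ u, HasDerivAt Ψ (ψ u) u) (hΨC : ∀ u, |Ψ u| ≤ C) (hψC : ∀ u, |ψ u| ≤ C) :
    Averages T (fun x => F x * ψ (2 * φ x / x.1)) := by
  have hF' := hF.mul (S.slow_y.comp S.smooth_inv)
  obtain ⟨D, hD, hDb⟩ := hF'.exists_deriv
  have bΨ : (fun x : ℝ × ℝ => Ψ (2 * φ x / x.1)) =O[slab T] (fun _ => (1 : ℝ)) :=
    isBigO_one_of_abs_le C fun _ => hΨC _
  have bψ : (fun x : ℝ × ℝ => ψ (2 * φ x / x.1)) =O[slab T] (fun _ => (1 : ℝ)) :=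
    isBigO_one_of_abs_le C fun _ => hψC _
  have bs : (fun x : ℝ × ℝ => sin (2 * φ x / x.1)) =O[slab T] (fun _ => (1 : ℝ)) :=
    isBigO_one_of_abs_le 1 fun _ => abs_sin_le_one _
  refine ⟨_, _, (hF'.bdd.mul_bdd bΨ).fst_mul.congr_left fun x => by ring,
    hD.mul (S.deriv_osc hΨ), ?_⟩
  refine ((hDb.mul_bdd bΨ).fst_mul.add (((hF'.bdd.mul_bdd bψ).mul_bdd
    ((S.bdd_rate.mul_bdd bs).const_mul_left 2)).fst_mul)).congr_left fun x => ?_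
  have := S.pos (y x)
  field_simp
  ring

lemma averages_sin (S : ActionAngleSystem T ω θs φ θ y q φ₀ y₀ p₀)
    {F : ℝ × ℝ → ℝ} (hF : IsSlow T F) :
    Averages T (fun x => F x * sin (2 * φ x / x.1)) :=
  S.averages_osc hF (Ψ := fun u => -cos u) (C := 1)
    (fun u => by simpa using (hasDerivAt_cos u).fun_neg) (fun u => by simpa using abs_cos_le_one u)
    abs_sin_le_one

lemma averages_sin_mul_cos (S : ActionAngleSystem T ω θs φ θ y q φ₀ y₀ p₀)
    {F : ℝ × ℝ → ℝ} (hF : IsSlow T F) :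
    Averages T (fun x => F x * (sin (2 * φ x / x.1) * cos (2 * φ x / x.1))) :=
  S.averages_osc hF (Ψ := fun u => sin u ^ 2 / 2) (ψ := fun u => sin u * cos u) (C := 1)
    (fun u => by
      refine (((hasDerivAt_sin u).fun_pow 2).div_const 2).congr_deriv ?_
      norm_num
      ring)
    (fun u => by
      rw [abs_of_nonneg (by positivity)]
      linarith [sin_sq_le_one u])
    (fun u => by
      rw [abs_mul]
      exact mul_le_one₀ (abs_sin_le_one u) (abs_nonneg _) (abs_cos_le_one u))

lemma slow_amplitude (S : ActionAngleSystem T ω θs φ θ y q φ₀ y₀ p₀) :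
    IsSlow T (fun x => q x * θ x * (deriv ω (y x) / (2 * ω (y x) ^ 2))) :=
  (S.slow_q.mul S.slow_θ).mul (S.slow_y.comp S.smooth_coeff)

/-- The action expanded to first order along the solution itself. -/
lemma action_expansion (S : ActionAngleSystem T ω θs φ θ y q φ₀ y₀ p₀) :
    (fun x => θ x - θs + q x * θ x * (deriv ω (y x) / (2 * ω (y x) ^ 2)) *
      (x.1 * sin (2 * φ x / x.1))) =O[slab T] (fun x => x.1 ^ 2) := by
  have sω := S.slow_y.comp S.smooth_deriv
  have sh := S.slow_y.comp S.smooth_coeff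
  have sh' := S.slow_y.comp (contDiff_infty_iff_deriv.1 S.smooth_coeff).2
  have hA := ((S.deriv_q.mul S.deriv_θ).mul (S.deriv_y.comp S.smooth_coeff)).mul
    (S.deriv_osc hasDerivAt_sin)
  have hG := (S.averages_sin
      ((((isSlow_const (-1)).mul (S.slow_θ.mul S.slow_θ)).mul (sω.mul sh)).add
        ((S.slow_q.mul S.slow_θ).mul (sh'.mul S.slow_q)))).add
    (S.averages_sin_mul_cos ((S.slow_θ.mul S.slow_θ).mul (sω.mul sh)))
  refine isBigO_sq_of_averages S.T_nonneg ((S.deriv_θ.sub (hasTimeDeriv_const θs)).add hA) hG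
    ((isBigO_zero _ _).congr_left fun x => ?_) ?_
  · have := S.pos (y x)
    field_simp
    ring
  · filter_upwards [S.initial] with ε h
    simp [h.1, h.2.1, S.init_φ₀]

lemma bdd_y₀ (S : ActionAngleSystem T ω θs φ θ y q φ₀ y₀ p₀) :
    (fun x : ℝ × ℝ => y₀ x.2) =O[slab T] (fun _ => (1 : ℝ)) :=
  isBigO_one_of_continuousOn fun t ht => (S.deriv_y₀ t ht).continuousAt.continuousWithinAt

lemma bdd_p₀ (S : ActionAngleSystem T ω θs φ θ y q φ₀ y₀ p₀) :
    (fun x : ℝ × ℝ => p₀ x.2) =O[slab T] (fun _ => (1 : ℝ)) :=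
  isBigO_one_of_continuousOn fun t ht => (S.deriv_p₀ t ht).continuousAt.continuousWithinAt

/-- The slow variables follow the homogenised ones: position to second order, velocity to
first order. -/
lemma slow_error (S : ActionAngleSystem T ω θs φ θ y q φ₀ y₀ p₀) :
    (fun x => y x - y₀ x.2) =O[slab T] (fun x => x.1 ^ 2) ∧
      (fun x => q x - p₀ x.2) =O[slab T] (fun x => x.1) := by
  have sω := S.slow_y.comp S.smooth_deriv
  have sh := S.slow_y.comp S.smooth_coeff
  have sb := S.slow_y.comp S.smooth_rate
  have sb' := S.slow_y.comp (contDiff_infty_iff_deriv.1 S.smooth_rate).2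
  have sB := S.slow_θ.mul sb
  obtain ⟨R₁, D₁, hR₁, hD₁, hRD₁⟩ := S.averages_sin sB
  obtain ⟨R₂, D₂, hR₂, hD₂, hRD₂⟩ := S.averages_sin
    ((S.slow_amplitude.mul sω).add
      (((isSlow_const (-1)).mul (S.slow_θ.mul S.slow_q)).mul sb'))
  have hy₀ : HasTimeDeriv T (fun x => y₀ x.2) (fun x => p₀ x.2) := by
    filter_upwards [eventually_slab_pos] with x hx using S.deriv_y₀ _ hx.2
  have hp₀ : HasTimeDeriv T (fun x => p₀ x.2) (fun x => -(θs * deriv ω (y₀ x.2))) := by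
    filter_upwards [eventually_slab_pos] with x hx using S.deriv_p₀ _ hx.2
  have hB := (S.deriv_θ.mul (S.deriv_y.comp S.smooth_rate)).mul (S.deriv_osc hasDerivAt_sin)
  have hY := (S.deriv_y.sub hD₁.fst_mul).sub hy₀
  have hQ := ((S.deriv_q.sub hB).sub hD₂.fst_mul).sub hp₀
  have key := isBigO_sq_of_gronwall (hY.prodMk hQ) ?_ ?_
  · have hε := isBigO_fst_sq_fst (T := T)
    refine ⟨?_, ?_⟩
    · exact ((key.prod_left_fst).add hR₁.fst_mul_sq).congr_left fun x => by ring
    · refine (((key.prod_left_snd.add hR₂.fst_mul_sq).trans hε).add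
        (sB.bdd.mul_bdd (isBigO_sin _)).fst_mul).congr_left fun x => by ring
  · set N : ℝ × ℝ → ℝ := fun x => ‖(y x - x.1 * R₁ x - y₀ x.2,
      q x - θ x * (deriv ω (y x) / (2 * ω (y x))) * (x.1 * sin (2 * φ x / x.1)) - x.1 * R₂ x
        - p₀ x.2)‖ + x.1 ^ 2 with hN
    have hsq : (fun x : ℝ × ℝ => x.1 ^ 2) =O[slab T] N := .of_bound 1 (.of_forall fun x => by
      rw [Real.norm_of_nonneg (by positivity), Real.norm_of_nonneg (by positivity)]
      simp only [hN, one_mul, le_add_iff_nonneg_left, norm_nonneg])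
    have hnorm : (fun x => (y x - x.1 * R₁ x - y₀ x.2,
        q x - θ x * (deriv ω (y x) / (2 * ω (y x))) * (x.1 * sin (2 * φ x / x.1)) - x.1 * R₂ x
          - p₀ x.2)) =O[slab T] N := .of_bound 1 (.of_forall fun x => by
      rw [Real.norm_of_nonneg (r := N x) (by positivity), one_mul]
      exact le_add_of_nonneg_right (sq_nonneg _))
    have hpos : (fun x => y x - y₀ x.2) =O[slab T] N :=
      (hnorm.prod_left_fst.add (hR₁.fst_mul_sq.trans hsq)).congr_left fun x => by ring
    refine IsBigO.prod_left ?_ ?_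
    · refine ((hnorm.prod_left_snd.add (hR₂.fst_mul_sq.trans hsq)).sub
        (hRD₁.fst_mul_sq.trans hsq)).congr_left fun x => by ring
    · have hforce := (isBigO_comp_sub_comp S.smooth_deriv S.bdd_y S.bdd_y₀).trans hpos
      have hX := S.action_expansion.mul_bdd S.bdd_deriv_ω
      refine (((hforce.const_mul_left (-θs)).sub (hX.trans hsq)).sub
        (hRD₂.fst_mul_sq.trans hsq)).congr_left fun x => ?_
      have := S.pos (y x)
      field_simp
      ring
  · have h0 : Tendsto (fun ε : ℝ => (ε, (0 : ℝ))) (𝓝[>] (0 : ℝ)) (slab T) :=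
      tendsto_slab_at ⟨le_rfl, S.T_nonneg⟩
    refine IsBigO.prod_left ?_ ?_
    · refine (hR₁.fst_mul_sq.comp_tendsto h0).neg_left.congr' ?_ .rfl
      filter_upwards [S.initial] with ε h
      simp [h.2.2.1]
    · refine (hR₂.fst_mul_sq.comp_tendsto h0).neg_left.congr' ?_ .rfl
      filter_upwards [S.initial] with ε h
      simp [h.1, h.2.2.2, S.init_φ₀]

lemma phase_error (S : ActionAngleSystem T ω θs φ θ y q φ₀ y₀ p₀) :
    (fun x => φ x - φ₀ x.2) =O[slab T] (fun x => x.1 ^ 2) := by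
  have hφ₀ : HasTimeDeriv T (fun x => φ₀ x.2) (fun x => ω (y₀ x.2)) := by
    filter_upwards [eventually_slab_pos] with x hx using S.deriv_φ₀ _ hx.2
  refine isBigO_sq_of_averages S.T_nonneg (S.deriv_φ.sub hφ₀)
    (S.averages_sin (S.slow_q.mul (S.slow_y.comp S.smooth_rate))) ?_ ?_
  · refine ((isBigO_comp_sub_comp S.smooth S.bdd_y S.bdd_y₀).trans
      S.slow_error.1).congr_left fun x => by ring
  · filter_upwards [S.initial] with ε h
    simp [h.1]

lemma sin_error (S : ActionAngleSystem T ω θs φ θ y q φ₀ y₀ p₀) :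
    (fun x => sin (2 * φ x / x.1) - sin (2 * φ₀ x.2 / x.1)) =O[slab T] (fun x => x.1) := by
  obtain ⟨C, hC⟩ := S.phase_error.bound
  refine .of_bound (2 * C) ?_
  filter_upwards [hC, eventually_slab_pos] with x hx hpos
  have hlip := abs_sin_sub_sin_le (2 * φ x / x.1) (2 * φ₀ x.2 / x.1)
  refine hlip.trans ?_
  rw [norm_pow, Real.norm_of_nonneg hpos.1.le] at hx
  rw [← sub_div, ← mul_sub, abs_div, abs_mul, abs_two, abs_of_pos hpos.1,
    div_le_iff₀ hpos.1, Real.norm_of_nonneg hpos.1.le]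
  rw [Real.norm_eq_abs] at hx
  linarith

lemma action_error (S : ActionAngleSystem T ω θs φ θ y q φ₀ y₀ p₀) :
    (fun x => θ x - θs) =O[slab T] (fun x => x.1) :=
  ((S.action_expansion.trans isBigO_fst_sq_fst).sub
    (S.slow_amplitude.bdd.mul_bdd (isBigO_sin fun x => 2 * φ x / x.1)).fst_mul).congr_left
    fun x => by ring

/-- The first-order correction of the action in terms of the homogenised solution. -/
theorem action_correction (S : ActionAngleSystem T ω θs φ θ y q φ₀ y₀ p₀) :
    (fun x => θ x - θs - x.1 * (-(θs * (deriv ω (y₀ x.2) * p₀ x.2 / ω (y₀ x.2)) /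
      (2 * ω (y₀ x.2))) * sin (2 * φ₀ x.2 / x.1))) =O[slab T] (fun x => x.1 ^ 2) := by
  have hh := (isBigO_comp_sub_comp S.smooth_coeff S.bdd_y S.bdd_y₀).trans
    (S.slow_error.1.trans isBigO_fst_sq_fst)
  have bh := (S.slow_y.comp S.smooth_coeff).bdd
  have hamp := (((S.slow_error.2.mul_bdd S.bdd_θ).mul_bdd bh).add
    ((S.action_error.mul_bdd S.bdd_p₀).mul_bdd bh)).add
    ((hh.mul_bdd S.bdd_p₀).const_mul_left θs)
  have hsin := (hamp.mul_bdd (isBigO_sin fun x => 2 * φ₀ x.2 / x.1)).add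
    (S.sin_error.mul_bdd S.slow_amplitude.bdd)
  refine (S.action_expansion.sub hsin.fst_mul_sq).congr_left fun x => ?_
  have := S.pos (y x)
  have := S.pos (y₀ x.2)
  field_simp
  ring

/-- The rescaled action error vanishes when integrated against a `C¹` function. -/
lemma tendsto_integral_of_contDiff (S : ActionAngleSystem T ω θs φ θ y q φ₀ y₀ p₀)
    (hθ : ∀ ε > 0, Continuous fun t => θ (ε, t)) {g : ℝ → ℝ}
    (hg : ContDiff ℝ 1 g) :
    Tendsto (fun ε : ℝ => ∫ t in Ioc (0 : ℝ) T, g t * ((θ (ε, t) - θs) / ε))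
      (𝓝[>] (0 : ℝ)) (𝓝 0) := by
  have hX : HasTimeDeriv T (fun x => ∫ t in (0 : ℝ)..x.2, g t * (θ (x.1, t) - θs))
      (fun x => g x.2 * (θ x - θs)) := by
    filter_upwards [eventually_slab_pos] with x hx
    have := hθ x.1 hx.1
    exact (hg.continuous.mul (this.sub continuous_const)).integral_hasStrictDerivAt 0 x.2
      |>.hasDerivAt
  have hsq := isBigO_sq_of_averages S.T_nonneg hX
    (S.averages_sin (((isSlow_const (-1)).mul (isSlow_of_contDiff hg)).mul S.slow_amplitude))
    ((S.action_expansion.mul_bdd (isSlow_of_contDiff hg).bdd).congr_left fun x => by ring)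
    (.of_forall fun ε => by simp)
  have hend := hsq.comp_tendsto (tendsto_slab_at ⟨S.T_nonneg, le_rfl⟩)
  have hlim : Tendsto (fun ε : ℝ => ε) (𝓝[>] (0 : ℝ)) (𝓝 0) :=
    tendsto_id.mono_left nhdsWithin_le_nhds
  refine IsBigO.trans_tendsto (g'' := fun ε : ℝ => ε) ?_ hlim
  obtain ⟨C, hC⟩ := hend.bound
  refine .of_bound C ?_
  filter_upwards [hC, self_mem_nhdsWithin] with ε h hε
  have hε : 0 < ε := hε
  simp only [Function.comp_apply, intervalIntegral.integral_of_le S.T_nonneg, norm_pow] at h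
  simp_rw [mul_div_assoc', integral_div]
  rw [norm_div, div_le_iff₀ (norm_pos_iff.2 hε.ne')]
  linarith

end ActionAngleSystem

/-- Weak-star convergence to zero of a bounded family on `(0, T]` can be tested on smooth
functions. -/
lemma tendsto_integral_mul_of_contDiff {T : ℝ} {F : ℝ × ℝ → ℝ}
    (hF : F =O[slab T] (fun _ => (1 : ℝ))) (hcont : ∀ ε > 0, Continuous fun t => F (ε, t))
    (hlim : ∀ g : ℝ → ℝ, ContDiff ℝ 1 g →
      Tendsto (fun ε : ℝ => ∫ t in Ioc (0 : ℝ) T, g t * F (ε, t)) (𝓝[>] (0 : ℝ)) (𝓝 0))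
    {g : ℝ → ℝ} (hg : Integrable g (volume.restrict (Ioc (0 : ℝ) T))) :
    Tendsto (fun ε : ℝ => ∫ t in Ioc (0 : ℝ) T, g t * F (ε, t)) (𝓝[>] (0 : ℝ)) (𝓝 0) := by
  obtain ⟨C, hC, hFC⟩ := hF.exists_pos
  have hFC := eventually_slab.1 hFC.bound
  rw [Metric.tendsto_nhds]
  intro δ hδ
  obtain ⟨h, -, hh, hgh⟩ := (memLp_one_iff_integrable.2 hg).exist_eLpNorm_sub_le
    (by simp) le_rfl (ε := δ / (2 * C)) (by positivity)
  have hhc : Integrable h (volume.restrict (Ioc (0 : ℝ) T)) :=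
    (hh.continuous.continuousOn.integrableOn_Icc).mono_set Ioc_subset_Icc_self
  have hgh' : ∫ t in Ioc (0 : ℝ) T, ‖g t - h t‖ ≤ δ / (2 * C) := by
    rw [eLpNorm_one_eq_lintegral_enorm] at hgh
    refine (integral_norm_eq_lintegral_enorm (hg.sub hhc).aestronglyMeasurable).trans_le ?_
    exact ENNReal.toReal_le_of_le_ofReal (by positivity) hgh
  have hlim' := Metric.tendsto_nhds.1 (hlim h (hh.of_le (by simp))) (δ / 2) (by positivity)
  filter_upwards [hFC, hlim', self_mem_nhdsWithin] with ε hb hl hε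
  have hb' : ∀ᵐ t ∂(volume.restrict (Ioc (0 : ℝ) T)), ‖F (ε, t)‖ ≤ C :=
    (ae_restrict_mem measurableSet_Ioc).mono fun t ht => by
      simpa using hb t (Ioc_subset_Icc_self ht)
  have hFm := (hcont ε hε).aestronglyMeasurable (μ := volume.restrict (Ioc (0 : ℝ) T))
  have hd : ‖∫ t in Ioc (0 : ℝ) T, (g t - h t) * F (ε, t)‖ ≤ δ / 2 := by
    calc ‖∫ t in Ioc (0 : ℝ) T, (g t - h t) * F (ε, t)‖
        ≤ ∫ t in Ioc (0 : ℝ) T, ‖g t - h t‖ * C := by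
          refine norm_integral_le_of_norm_le ((hg.sub hhc).norm.mul_const C) ?_
          filter_upwards [hb'] with t ht
          rw [norm_mul]
          gcongr
      _ ≤ δ / (2 * C) * C := by
          rw [integral_mul_const]
          gcongr
      _ = δ / 2 := by field_simp
  have hsplit : ∫ t in Ioc (0 : ℝ) T, g t * F (ε, t) =
      (∫ t in Ioc (0 : ℝ) T, (g t - h t) * F (ε, t)) + ∫ t in Ioc (0 : ℝ) T, h t * F (ε, t) := by
    refine (integral_congr_ae (.of_forall fun t => ?_)).trans
      (integral_add ((hg.sub hhc).mul_bdd hFm hb') (hhc.mul_bdd hFm hb'))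
    change g t * F (ε, t) = (g t - h t) * F (ε, t) + h t * F (ε, t)
    ring
  rw [dist_zero_right] at hl ⊢
  rw [hsplit]
  linarith [norm_add_le (∫ t in Ioc (0 : ℝ) T, (g t - h t) * F (ε, t))
    (∫ t in Ioc (0 : ℝ) T, h t * F (ε, t))]

lemma isBigO_one_of_tendstoUniformlyOn {T : ℝ} {f : ℝ → ℝ → ℝ} {f₀ : ℝ → ℝ}
    (h : TendstoUniformlyOn f f₀ (𝓝[>] (0 : ℝ)) (Icc 0 T)) (hf₀ : Continuous f₀) :
    (fun x : ℝ × ℝ => f x.1 x.2) =O[slab T] (fun _ => (1 : ℝ)) := by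
  have hdiff : (fun x : ℝ × ℝ => f x.1 x.2 - f₀ x.2) =O[slab T] (fun _ => (1 : ℝ)) := by
    refine .of_bound 1 (eventually_slab.2 ?_)
    filter_upwards [Metric.tendstoUniformlyOn_iff.1 h 1 one_pos] with ε hε t ht
    simpa [dist_comm, dist_eq_norm] using (hε t ht).le
  exact (hdiff.add (isBigO_one_of_continuousOn hf₀.continuousOn)).congr_left fun x => by ring

/-- First-order correction of the action variable:
`θ_ε − θ_* = ε[θ₁]^ε + O(ε²)` uniformly on `[0,T]`, where
`[θ₁]^ε(t) = −(θ_*(d/dt log ω(y₀))/(2ω(y₀))) sin(2φ₀/ε)`; in particular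
`ε⁻¹(θ_ε − θ_*) ⇀* 0` in `L^∞((0,T))`. -/
theorem stmt8 (T : ℝ) (hT : 0 < T)
    (ω : ℝ → ℝ) (hω : ContDiff ℝ (⊤ : ℕ∞) ω)
    (ωs : ℝ) (hωs : 0 < ωs) (hωlb : ∀ x, ωs ≤ ω x)
    (φ θ y p : ℝ → ℝ → ℝ)
    (hreg : ∀ ε > (0:ℝ), ContDiff ℝ 1 (φ ε) ∧ ContDiff ℝ 1 (θ ε) ∧
      ContDiff ℝ 1 (y ε) ∧ ContDiff ℝ 1 (p ε))
    (ys ps us θs : ℝ) (hθs : θs = us ^ 2 / (2 * ω ys))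
    (hinit : ∀ ε > (0:ℝ), φ ε 0 = 0 ∧ θ ε 0 = θs ∧ y ε 0 = ys ∧ p ε 0 = ps)
    (hφode : ∀ ε > (0:ℝ), ∀ t ∈ Icc (0:ℝ) T,
      deriv (φ ε) t = ω (y ε t)
        + ε * (p ε t * deriv ω (y ε t) / (2 * ω (y ε t))) * Real.sin (2 * φ ε t / ε)
        + ε ^ 2 * (θ ε t * (deriv ω (y ε t)) ^ 2 / (4 * (ω (y ε t)) ^ 2))
            * (Real.sin (2 * φ ε t / ε)) ^ 2)
    (hθode : ∀ ε > (0:ℝ), ∀ t ∈ Icc (0:ℝ) T,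
      deriv (θ ε) t
        = -(θ ε t * p ε t * deriv ω (y ε t) / ω (y ε t)) * Real.cos (2 * φ ε t / ε)
          - ε * ((θ ε t) ^ 2 * (deriv ω (y ε t)) ^ 2 / (4 * (ω (y ε t)) ^ 2))
              * Real.sin (4 * φ ε t / ε))
    (hyode : ∀ ε > (0:ℝ), ∀ t ∈ Icc (0:ℝ) T,
      deriv (y ε) t = p ε t
        + ε * (θ ε t * deriv ω (y ε t) / (2 * ω (y ε t))) * Real.sin (2 * φ ε t / ε))
    (hpode : ∀ ε > (0:ℝ), ∀ t ∈ Icc (0:ℝ) T,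
      deriv (p ε) t = -(θ ε t * deriv ω (y ε t))
        + ε * (θ ε t * p ε t * (deriv ω (y ε t)) ^ 2 / (2 * (ω (y ε t)) ^ 2))
            * Real.sin (2 * φ ε t / ε)
        - ε * (θ ε t * p ε t * deriv (deriv ω) (y ε t) / (2 * ω (y ε t)))
            * Real.sin (2 * φ ε t / ε)
        + ε ^ 2 * ((θ ε t) ^ 2 * (deriv ω (y ε t)) ^ 3 / (4 * (ω (y ε t)) ^ 3))
            * (Real.sin (2 * φ ε t / ε)) ^ 2
        - ε ^ 2 * ((θ ε t) ^ 2 * deriv ω (y ε t) * deriv (deriv ω) (y ε t)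
              / (4 * (ω (y ε t)) ^ 2))
            * (Real.sin (2 * φ ε t / ε)) ^ 2)
    (φ₀ y₀ p₀ : ℝ → ℝ)
    (hlimreg : ContDiff ℝ 1 φ₀ ∧ ContDiff ℝ 1 y₀ ∧ ContDiff ℝ 1 p₀)
    (hliminit : φ₀ 0 = 0 ∧ y₀ 0 = ys ∧ p₀ 0 = ps)
    (hlimode : ∀ t ∈ Icc (0:ℝ) T,
      deriv φ₀ t = ω (y₀ t) ∧ deriv y₀ t = p₀ t ∧
      deriv p₀ t = -(θs * deriv ω (y₀ t)))
    (hconv_y : TendstoUniformlyOn (fun ε t => y ε t) y₀ (𝓝[>] (0:ℝ)) (Icc 0 T))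
    (hconv_p : TendstoUniformlyOn (fun ε t => p ε t) p₀ (𝓝[>] (0:ℝ)) (Icc 0 T))
    (hconv_θ : TendstoUniformlyOn (fun ε t => θ ε t) (fun _ => θs) (𝓝[>] (0:ℝ)) (Icc 0 T))
    (hconv_φ : TendstoUniformlyOn (fun ε t => φ ε t) φ₀ (𝓝[>] (0:ℝ)) (Icc 0 T))
    :
    (∃ K > (0:ℝ), ∃ ε₀ > (0:ℝ), ∀ ε : ℝ, 0 < ε → ε < ε₀ → ∀ t ∈ Icc (0:ℝ) T,
      |θ ε t - θs
        - ε * (-(θs * (deriv ω (y₀ t) * p₀ t / ω (y₀ t)) / (2 * ω (y₀ t)))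
            * Real.sin (2 * φ₀ t / ε))| ≤ K * ε ^ 2) ∧
    (∀ g : ℝ → ℝ, Integrable g (volume.restrict (Ioc (0:ℝ) T)) →
      Tendsto (fun ε : ℝ => ∫ t in Ioc (0:ℝ) T, g t * ((θ ε t - θs) / ε))
        (𝓝[>] (0:ℝ)) (𝓝 0)) := by
  have hpos : ∀ u, 0 < ω u := fun u => hωs.trans_le (hωlb u)
  have hω' : ContDiff ℝ (⊤ : ℕ∞) (deriv ω) := (contDiff_infty_iff_deriv.1 hω).2
  have dφ : ∀ ε > 0, ∀ t, HasDerivAt (φ ε) (deriv (φ ε) t) t := fun ε hε t =>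
    ((hreg ε hε).1.differentiable (by simp) t).hasDerivAt
  have dθ : ∀ ε > 0, ∀ t, HasDerivAt (θ ε) (deriv (θ ε) t) t := fun ε hε t =>
    ((hreg ε hε).2.1.differentiable (by simp) t).hasDerivAt
  have dy : ∀ ε > 0, ∀ t, HasDerivAt (y ε) (deriv (y ε) t) t := fun ε hε t =>
    ((hreg ε hε).2.2.1.differentiable (by simp) t).hasDerivAt
  have dp : ∀ ε > 0, ∀ t, HasDerivAt (p ε) (deriv (p ε) t) t := fun ε hε t =>
    ((hreg ε hε).2.2.2.differentiable (by simp) t).hasDerivAt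
  have bθ := isBigO_one_of_tendstoUniformlyOn hconv_θ continuous_const
  have b_y := isBigO_one_of_tendstoUniformlyOn hconv_y hlimreg.2.1.continuous
  have bp := isBigO_one_of_tendstoUniformlyOn hconv_p hlimreg.2.2.continuous
  have hrate : Continuous fun u => deriv ω u / (2 * ω u) :=
    hω'.continuous.div (continuous_const.mul hω.continuous) fun u => by
      have := hpos u
      positivity
  have S : ActionAngleSystem T ω θs (fun x => φ x.1 x.2) (fun x => θ x.1 x.2)
      (fun x => y x.1 x.2)
      (fun x => p x.1 x.2 + θ x.1 x.2 * (deriv ω (y x.1 x.2) / (2 * ω (y x.1 x.2))) *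
        (x.1 * sin (2 * φ x.1 x.2 / x.1))) φ₀ y₀ p₀ :=
    { T_nonneg := hT.le
      smooth := hω
      pos := hpos
      bdd_θ := bθ
      bdd_y := b_y
      bdd_q := bp.add ((bθ.mul_bdd (isBigO_comp_of_continuous hrate b_y)).mul_bdd
        (isBigO_fst_one.mul_bdd (isBigO_sin _)))
      deriv_φ := by
        filter_upwards [eventually_slab_pos] with x hx
        refine (dφ x.1 hx.1 x.2).congr_deriv ?_
        rw [hφode x.1 hx.1 x.2 hx.2]
        have := hpos (y x.1 x.2)
        field_simp
        ring
      deriv_θ := by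
        filter_upwards [eventually_slab_pos] with x hx
        refine (dθ x.1 hx.1 x.2).congr_deriv ?_
        rw [hθode x.1 hx.1 x.2 hx.2,
          show 4 * φ x.1 x.2 / x.1 = 2 * (2 * φ x.1 x.2 / x.1) by ring, sin_two_mul]
        have := hpos (y x.1 x.2)
        field_simp
        ring
      deriv_y := by
        filter_upwards [eventually_slab_pos] with x hx
        refine (dy x.1 hx.1 x.2).congr_deriv ?_
        rw [hyode x.1 hx.1 x.2 hx.2]
        ring
      deriv_q := by
        filter_upwards [eventually_slab_pos] with x hx
        have hε := hx.1.ne'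
        have hw := hpos (y x.1 x.2)
        have dω := (hω.differentiable (by simp) (y x.1 x.2)).hasDerivAt
        have dω' := (hω'.differentiable (by simp) (y x.1 x.2)).hasDerivAt
        have drate := (dω'.div (dω.const_mul 2) (by positivity)).comp x.2 (dy x.1 hx.1 x.2)
        have dsin := ((((dφ x.1 hx.1 x.2).const_mul 2).div_const x.1).sin).const_mul x.1
        refine ((dp x.1 hx.1 x.2).add (((dθ x.1 hx.1 x.2).mul drate).mul dsin)).congr_deriv ?_
        rw [hpode x.1 hx.1 x.2 hx.2, hθode x.1 hx.1 x.2 hx.2, hyode x.1 hx.1 x.2 hx.2,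
          hφode x.1 hx.1 x.2 hx.2,
          show 4 * φ x.1 x.2 / x.1 = 2 * (2 * φ x.1 x.2 / x.1) by ring, sin_two_mul]
        simp only [Pi.mul_apply, Pi.div_apply, Function.comp_apply]
        generalize sin (2 * φ x.1 x.2 / x.1) = s
        generalize cos (2 * φ x.1 x.2 / x.1) = c
        field_simp
        ring
      initial := by
        filter_upwards [self_mem_nhdsWithin] with ε hε
        obtain ⟨h1, h2, h3, h4⟩ := hinit ε hε
        simp [h1, h2, h3, h4, hliminit.1, hliminit.2.1, hliminit.2.2]
      init_φ₀ := hliminit.1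
      deriv_φ₀ := fun t ht => ((hlimreg.1.differentiable (by simp) t).hasDerivAt).congr_deriv
        (hlimode t ht).1
      deriv_y₀ := fun t ht => ((hlimreg.2.1.differentiable (by simp) t).hasDerivAt).congr_deriv
        (hlimode t ht).2.1
      deriv_p₀ := fun t ht => ((hlimreg.2.2.differentiable (by simp) t).hasDerivAt).congr_deriv
        (hlimode t ht).2.2 }
  have hθc : ∀ ε > 0, Continuous (θ ε) := fun ε hε => (hreg ε hε).2.1.continuous
  refine ⟨?_, fun g hg => ?_⟩
  · obtain ⟨K, hK, hbound⟩ := S.action_correction.exists_pos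
    obtain ⟨ε₀, hε₀, h⟩ := (mem_nhdsGT_iff_exists_Ioo_subset).1 (eventually_slab.1 hbound.bound)
    refine ⟨K, hK, ε₀, hε₀, fun ε hε hεlt t ht => ?_⟩
    simpa using h ⟨hε, hεlt⟩ t ht
  · refine tendsto_integral_mul_of_contDiff (F := fun x => (θ x.1 x.2 - θs) / x.1) ?_
      (fun ε hε => ((hθc ε hε).sub continuous_const).div_const ε)
      (fun g hg => S.tendsto_integral_of_contDiff hθc hg) hg
    obtain ⟨C, hC⟩ := S.action_error.bound
    refine .of_bound C ?_
    filter_upwards [hC, eventually_slab_pos] with x hx hpos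
    rw [norm_div, div_le_iff₀ (norm_pos_iff.2 hpos.1.ne')]
    simpa using hx
end

section
/- Let u ∈ C²(ℝ_{>0} × ℝ³) and let (φ_ε, θ_ε, y_ε, p_ε) be the solution of the action-angle system with the convergences of the homogenised limit. Set u_ε := u(φ̇_ε, θ_ε, ẏ_ε, y_ε). Then for all a, b ∈ [0,T], ∫_a^b u̇_ε cos(2φ_ε/ε) dt → ½ ∫_a^b [ (d/dt log ω(y₀)) (ω(y₀) ∂₁u₀ − θ_* ∂₂u₀) + θ_* ω'(y₀) ∂₃u₀ ] dt, and ∫_a^b u̇_ε sin(2φ_ε/ε) dt = O(ε), where u₀ = u(ω(y₀), θ_*, p₀, y₀). -/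
open Real Set Filter Topology intervalIntegral

/-- A solution `(q, φ)` on `[0, T]` of the fast-slow system
`q̇ = V₀(q) + cos(2φ/ε) V₁(q)`, `φ̇ = Φ(q)`, with slow variable confined to `K`. -/
structure IsFastSlow {E : Type*} [NormedAddCommGroup E] [NormedSpace ℝ E] (T : ℝ) (K : Set E)
    (Φ : E → ℝ) (V₀ V₁ : E → E) (ε : ℝ) (φ : ℝ → ℝ) (q : ℝ → E) : Prop where
  mem : ∀ t ∈ Icc (0:ℝ) T, q t ∈ K
  slow : ∀ t ∈ Icc (0:ℝ) T,
    HasDerivWithinAt q (V₀ (q t) + Real.cos (2 * φ t / ε) • V₁ (q t)) (Icc 0 T) t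
  fast : ∀ t ∈ Icc (0:ℝ) T, HasDerivWithinAt φ (Φ (q t)) (Icc 0 T) t

section FastSlow

variable {E : Type*} [NormedAddCommGroup E] [NormedSpace ℝ E] {T : ℝ} {W K : Set E}
  {Φ : E → ℝ} {V₀ V₁ : E → E}

namespace IsFastSlow

variable {ε : ℝ} {φ : ℝ → ℝ} {q : ℝ → E}

lemma continuousOn_slow (h : IsFastSlow T K Φ V₀ V₁ ε φ q) : ContinuousOn q (Icc 0 T) :=
  fun t ht => (h.slow t ht).continuousWithinAt

lemma continuousOn_fast (h : IsFastSlow T K Φ V₀ V₁ ε φ q) : ContinuousOn φ (Icc 0 T) :=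
  fun t ht => (h.fast t ht).continuousWithinAt

lemma continuousOn_comp {F : Type*} [TopologicalSpace F] (h : IsFastSlow T K Φ V₀ V₁ ε φ q)
    {G : E → F} (hG : ContinuousOn G W) (hKW : K ⊆ W) :
    ContinuousOn (fun t => G (q t)) (Icc 0 T) :=
  hG.comp h.continuousOn_slow fun t ht => hKW (h.mem t ht)

lemma hasDerivWithinAt_comp {H : E → ℝ} (h : IsFastSlow T K Φ V₀ V₁ ε φ q) (hW : IsOpen W)
    (hKW : K ⊆ W) (hH : ContDiffOn ℝ 1 H W) {t : ℝ} (ht : t ∈ Icc (0:ℝ) T) :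
    HasDerivWithinAt (fun s => H (q s)) (fderiv ℝ H (q t) (V₀ (q t))
      + fderiv ℝ H (q t) (V₁ (q t)) * Real.cos (2 * φ t / ε)) (Icc 0 T) t := by
  have hmem := hKW (h.mem t ht)
  have hd : HasFDerivAt H (fderiv ℝ H (q t)) (q t) :=
    ((hH.differentiableOn one_ne_zero).differentiableAt (hW.mem_nhds hmem)).hasFDerivAt
  exact (hd.comp_hasDerivWithinAt t (h.slow t ht)).congr_deriv (by simp [mul_comm])

end IsFastSlow

/-- Uniform oscillatory integral lemma along solutions of a fast-slow system. -/
lemma exists_abs_integral_mul_cos_le (hW : IsOpen W) (hK : IsCompact K) (hKW : K ⊆ W)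
    (hΦ : ContDiffOn ℝ 1 Φ W) (hpos : ∀ x ∈ W, 0 < Φ x)
    (hV₀ : ContinuousOn V₀ W) (hV₁ : ContinuousOn V₁ W)
    {G : E → ℝ} (hG : ContDiffOn ℝ 1 G W) :
    ∃ M : ℝ, ∀ (ε : ℝ) (φ : ℝ → ℝ) (q : ℝ → E), 0 < ε → IsFastSlow T K Φ V₀ V₁ ε φ q →
      ∀ k : ℝ, 1 ≤ k → ∀ α : ℝ, ∀ a ∈ Icc (0:ℝ) T, ∀ b ∈ Icc (0:ℝ) T,
        |∫ t in a..b, G (q t) * Real.cos (k * φ t / ε + α)| ≤ M * ε := by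
  have hH : ContDiffOn ℝ 1 (fun x => G x / Φ x) W := hG.div hΦ fun x hx => (hpos x hx).ne'
  set H : E → ℝ := fun x => G x / Φ x with hHdef
  have hfd : ContinuousOn (fderiv ℝ H) W := hH.continuousOn_fderiv_of_isOpen hW le_rfl
  have hD₀ : ContinuousOn (fun x => fderiv ℝ H x (V₀ x)) W := hfd.clm_apply hV₀
  have hD₁ : ContinuousOn (fun x => fderiv ℝ H x (V₁ x)) W := hfd.clm_apply hV₁
  obtain ⟨M, hM⟩ := hK.exists_bound_of_continuousOn (hH.continuousOn.mono hKW)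
  obtain ⟨N₀, hN₀⟩ := hK.exists_bound_of_continuousOn (hD₀.mono hKW)
  obtain ⟨N₁, hN₁⟩ := hK.exists_bound_of_continuousOn (hD₁.mono hKW)
  refine ⟨2 * M + (N₀ + N₁) * T, fun ε φ q hε h k hk α a ha b hb => ?_⟩
  have hk0 : 0 < k := by linarith
  have hsub : uIcc a b ⊆ Icc (0:ℝ) T := uIcc_subset_Icc ha hb
  have hphase : ContinuousOn (fun t => k * φ t / ε + α) (Icc 0 T) :=
    ((continuousOn_const.mul h.continuousOn_fast).div_const _).add continuousOn_const
  set D : ℝ → ℝ := fun t => fderiv ℝ H (q t) (V₀ (q t))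
      + fderiv ℝ H (q t) (V₁ (q t)) * Real.cos (2 * φ t / ε) with hDdef
  set R : ℝ → ℝ := fun t => ε / k * Real.sin (k * φ t / ε + α) with hRdef
  have hDc : ContinuousOn D (Icc 0 T) :=
    (h.continuousOn_comp hD₀ hKW).add ((h.continuousOn_comp hD₁ hKW).mul
      (Real.continuous_cos.comp_continuousOn
        ((continuousOn_const.mul h.continuousOn_fast).div_const _)))
  have hRc : ContinuousOn R (Icc 0 T) :=
    continuousOn_const.mul (Real.continuous_sin.comp_continuousOn hphase)
  have hHc : ContinuousOn (fun t => H (q t)) (Icc 0 T) :=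
    h.continuousOn_comp hH.continuousOn hKW
  have hGc : ContinuousOn (fun t => G (q t) * Real.cos (k * φ t / ε + α)) (Icc 0 T) :=
    (h.continuousOn_comp hG.continuousOn hKW).mul (Real.continuous_cos.comp_continuousOn hphase)
  have hRle : ∀ t, |R t| ≤ ε := fun t => by
    rw [hRdef, abs_mul, abs_of_pos (div_pos hε hk0)]
    calc ε / k * |Real.sin (k * φ t / ε + α)| ≤ ε * 1 :=
          mul_le_mul (div_le_self hε.le hk) (Real.abs_sin_le_one _) (abs_nonneg _) hε.le
      _ = ε := mul_one ε
  have hDle : ∀ t ∈ Icc (0:ℝ) T, |D t| ≤ N₀ + N₁ := fun t ht => by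
    refine (abs_add_le _ _).trans (add_le_add (hN₀ _ (h.mem t ht)) ?_)
    rw [abs_mul]
    exact (mul_le_of_le_one_right (abs_nonneg _) (Real.abs_cos_le_one _)).trans
      (hN₁ _ (h.mem t ht))
  have hderiv : ∀ t ∈ Icc (0:ℝ) T, HasDerivWithinAt (fun s => H (q s) * R s)
      (D t * R t + G (q t) * Real.cos (k * φ t / ε + α)) (Icc 0 T) t := fun t ht => by
    have hR : HasDerivWithinAt R (Φ (q t) * Real.cos (k * φ t / ε + α)) (Icc 0 T) t := by
      refine (((((h.fast t ht).const_mul k).div_const ε).add_const α).sin.const_mul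
        (ε / k)).congr_deriv ?_
      field_simp
    refine ((h.hasDerivWithinAt_comp hW hKW hH ht).mul hR).congr_deriv ?_
    have hΦ0 := (hpos _ (hKW (h.mem t ht))).ne'
    have hHΦ : H (q t) * Φ (q t) = G (q t) := div_mul_cancel₀ _ hΦ0
    rw [← hHΦ, mul_assoc]
  have hint₁ : IntervalIntegrable (fun t => D t * R t) MeasureTheory.volume a b :=
    ((hDc.mul hRc).mono hsub).intervalIntegrable
  have hint₂ : IntervalIntegrable (fun t => G (q t) * Real.cos (k * φ t / ε + α))
      MeasureTheory.volume a b := (hGc.mono hsub).intervalIntegrable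
  have hftc := integral_eq_sub_of_hasDeriv_right ((hHc.mul hRc).mono hsub)
    (f' := fun t => D t * R t + G (q t) * Real.cos (k * φ t / ε + α))
    (fun t ht => by
      have htI : t ∈ Ioo (0:ℝ) T :=
        ⟨(le_min ha.1 hb.1).trans_lt ht.1, ht.2.trans_le (max_le ha.2 hb.2)⟩
      exact ((hderiv t (Ioo_subset_Icc_self htI)).hasDerivAt
        (Icc_mem_nhds htI.1 htI.2)).hasDerivWithinAt)
    (hint₁.add hint₂)
  rw [integral_add hint₁ hint₂] at hftc
  have hDR : |∫ t in a..b, D t * R t| ≤ (N₀ + N₁) * ε * T := by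
    have hN : 0 ≤ N₀ + N₁ := (abs_nonneg _).trans (hDle a ha)
    rw [← Real.norm_eq_abs]
    refine (norm_integral_le_of_norm_le_const (C := (N₀ + N₁) * ε) fun t ht => ?_).trans ?_
    · rw [Real.norm_eq_abs, abs_mul]
      exact mul_le_mul (hDle t (hsub (uIoc_subset_uIcc ht))) (hRle t) (abs_nonneg _) hN
    · refine mul_le_mul_of_nonneg_left ?_ (mul_nonneg hN hε.le)
      rw [abs_le]
      constructor <;> linarith [ha.1, ha.2, hb.1, hb.2]
  have hbd : ∀ t ∈ Icc (0:ℝ) T, |H (q t) * R t| ≤ M * ε := fun t ht => by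
    rw [abs_mul]
    exact mul_le_mul (hM _ (h.mem t ht)) (hRle t) (abs_nonneg _)
      ((abs_nonneg _).trans (hM _ (h.mem t ht)))
  have hA := abs_le.1 (hbd a ha)
  have hB := abs_le.1 (hbd b hb)
  have hDR' := abs_le.1 hDR
  simp only [Pi.mul_apply] at hftc
  rw [abs_le]
  constructor <;> nlinarith [hA.1, hA.2, hB.1, hB.2, hDR'.1, hDR'.2]

/-- Averages of `G₀(q) + G₁(q) cos(2φ/ε)` against `sin(2φ/ε)` and `cos(2φ/ε)` along a fast-slow
solution agree with their formal limits up to `O(ε)`. -/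
lemma exists_abs_integral_oscillation_le (hW : IsOpen W) (hK : IsCompact K) (hKW : K ⊆ W)
    (hΦ : ContDiffOn ℝ 1 Φ W) (hpos : ∀ x ∈ W, 0 < Φ x)
    (hV₀ : ContinuousOn V₀ W) (hV₁ : ContinuousOn V₁ W)
    {G₀ G₁ : E → ℝ} (hG₀ : ContDiffOn ℝ 1 G₀ W) (hG₁ : ContDiffOn ℝ 1 G₁ W) :
    ∃ M : ℝ, ∀ (ε : ℝ) (φ : ℝ → ℝ) (q : ℝ → E), 0 < ε → IsFastSlow T K Φ V₀ V₁ ε φ q →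
      ∀ a ∈ Icc (0:ℝ) T, ∀ b ∈ Icc (0:ℝ) T,
        |∫ t in a..b, (G₀ (q t) + G₁ (q t) * Real.cos (2 * φ t / ε))
          * Real.sin (2 * φ t / ε)| ≤ M * ε ∧
        |(∫ t in a..b, (G₀ (q t) + G₁ (q t) * Real.cos (2 * φ t / ε))
          * Real.cos (2 * φ t / ε)) - 1 / 2 * ∫ t in a..b, G₁ (q t)| ≤ M * ε := by
  obtain ⟨M₀, hM₀⟩ := exists_abs_integral_mul_cos_le (T := T) hW hK hKW hΦ hpos hV₀ hV₁ hG₀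
  obtain ⟨M₁, hM₁⟩ := exists_abs_integral_mul_cos_le (T := T) hW hK hKW hΦ hpos hV₀ hV₁ hG₁
  refine ⟨M₀ + 1 / 2 * M₁, fun ε φ q hε h a ha b hb => ?_⟩
  have hsub : uIcc a b ⊆ Icc (0:ℝ) T := uIcc_subset_Icc ha hb
  have hint : ∀ G : E → ℝ, ContDiffOn ℝ 1 G W → ∀ k α : ℝ,
      IntervalIntegrable (fun t => G (q t) * Real.cos (k * φ t / ε + α))
        MeasureTheory.volume a b := fun G hG k α =>
    (((h.continuousOn_comp hG.continuousOn hKW).mul (Real.continuous_cos.comp_continuousOn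
      (((continuousOn_const.mul h.continuousOn_fast).div_const _).add
        continuousOn_const))).mono hsub).intervalIntegrable
  have hint₁ : IntervalIntegrable (fun t => G₁ (q t)) MeasureTheory.volume a b :=
    ((h.continuousOn_comp hG₁.continuousOn hKW).mono hsub).intervalIntegrable
  have key : ∀ α : ℝ, |(∫ t in a..b, G₀ (q t) * Real.cos (2 * φ t / ε + α))
      + 1 / 2 * ∫ t in a..b, G₁ (q t) * Real.cos (4 * φ t / ε + α)|
      ≤ (M₀ + 1 / 2 * M₁) * ε := fun α => by
    have h0 := hM₀ ε φ q hε h 2 (by norm_num) α a ha b hb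
    have h1 := hM₁ ε φ q hε h 4 (by norm_num) α a ha b hb
    rw [abs_le] at *
    constructor <;> linarith [h0.1, h0.2, h1.1, h1.2]
  constructor
  · convert key (-(π / 2)) using 2
    rw [← integral_const_mul, ← integral_add (hint G₀ hG₀ _ _) ((hint G₁ hG₁ _ _).const_mul _)]
    congr 1
    funext t
    have h4 : 4 * φ t / ε = 2 * (2 * φ t / ε) := by ring
    rw [← sub_eq_add_neg, ← sub_eq_add_neg, Real.cos_sub_pi_div_two, Real.cos_sub_pi_div_two,
      h4, Real.sin_two_mul]
    ring
  · convert key 0 using 2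
    rw [sub_eq_iff_eq_add, ← integral_const_mul, ← integral_const_mul,
      ← integral_add (hint G₀ hG₀ _ _) ((hint G₁ hG₁ _ _).const_mul _),
      ← integral_add ((hint G₀ hG₀ _ _).add ((hint G₁ hG₁ _ _).const_mul _))
        (hint₁.const_mul _)]
    congr 1
    funext t
    have h4 : 4 * φ t / ε = 2 * (2 * φ t / ε) := by ring
    rw [add_zero, add_zero, h4, Real.cos_two_mul]
    ring

/-- Averaging: if the slow variable converges uniformly to `q₀`, then the derivative of an
observable `U` along solutions, tested against `cos(2φ/ε)` and `sin(2φ/ε)`, has a limit,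
respectively is `O(ε)`. -/
lemma tendsto_integral_deriv_mul_cos [ProperSpace E] (hW : IsOpen W)
    (hΦ : ContDiffOn ℝ 1 Φ W) (hpos : ∀ x ∈ W, 0 < Φ x)
    (hV₀ : ContDiffOn ℝ 1 V₀ W) (hV₁ : ContDiffOn ℝ 1 V₁ W)
    {U : E → ℝ} (hU : ContDiffOn ℝ 2 U W)
    {φ : ℝ → ℝ → ℝ} {q : ℝ → ℝ → E} {q₀ : ℝ → E}
    (hq₀ : ContinuousOn q₀ (Icc 0 T)) (hq₀W : ∀ t ∈ Icc (0:ℝ) T, q₀ t ∈ W)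
    (hconv : TendstoUniformlyOn q q₀ (𝓝[>] (0:ℝ)) (Icc 0 T))
    (hsol : ∀ ε > (0:ℝ), IsFastSlow T univ Φ V₀ V₁ ε (φ ε) (q ε))
    {a b : ℝ} (ha : a ∈ Icc (0:ℝ) T) (hb : b ∈ Icc (0:ℝ) T) :
    Tendsto (fun ε : ℝ => ∫ t in a..b,
        deriv (fun s => U (q ε s)) t * Real.cos (2 * φ ε t / ε)) (𝓝[>] (0:ℝ))
      (𝓝 (1 / 2 * ∫ t in a..b, fderiv ℝ U (q₀ t) (V₁ (q₀ t)))) ∧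
    ∃ M : ℝ, ∀ᶠ ε in 𝓝[>] (0:ℝ), |∫ t in a..b,
        deriv (fun s => U (q ε s)) t * Real.sin (2 * φ ε t / ε)| ≤ M * ε := by
  have hS : IsCompact (q₀ '' Icc 0 T) := isCompact_Icc.image_of_continuousOn hq₀
  obtain ⟨δ, hδ, hKW⟩ := hS.exists_cthickening_subset_open hW (image_subset_iff.2 hq₀W)
  set K := Metric.cthickening δ (q₀ '' Icc 0 T) with hKdef
  have hK : IsCompact K := hS.cthickening
  have hfd : ContDiffOn ℝ 1 (fderiv ℝ U) W := hU.fderiv_of_isOpen hW (by norm_num)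
  have hG₀ : ContDiffOn ℝ 1 (fun x => fderiv ℝ U x (V₀ x)) W := hfd.clm_apply hV₀
  have hG₁ : ContDiffOn ℝ 1 (fun x => fderiv ℝ U x (V₁ x)) W := hfd.clm_apply hV₁
  have hsub : uIcc a b ⊆ Icc (0:ℝ) T := uIcc_subset_Icc ha hb
  have hev : ∀ᶠ ε in 𝓝[>] (0:ℝ), 0 < ε ∧ IsFastSlow T K Φ V₀ V₁ ε (φ ε) (q ε) := by
    filter_upwards [self_mem_nhdsWithin, Metric.tendstoUniformlyOn_iff.1 hconv δ hδ]
      with ε hε hd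
    refine ⟨hε, fun t ht => ?_, (hsol ε hε).slow, (hsol ε hε).fast⟩
    exact Metric.mem_cthickening_of_dist_le _ _ _ _ (mem_image_of_mem q₀ ht)
      (by rw [dist_comm]; exact (hd t ht).le)
  have hrepl : ∀ᶠ ε in 𝓝[>] (0:ℝ), ∀ f : ℝ → ℝ,
      ∫ t in a..b, deriv (fun s => U (q ε s)) t * f t
        = ∫ t in a..b, (fderiv ℝ U (q ε t) (V₀ (q ε t))
          + fderiv ℝ U (q ε t) (V₁ (q ε t)) * Real.cos (2 * φ ε t / ε)) * f t := by
    filter_upwards [hev] with ε hε f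
    refine integral_congr_ae ?_
    have hT : ∀ᵐ t : ℝ, t ≠ T := by simp [MeasureTheory.ae_iff]
    filter_upwards [hT] with t htT ht
    have htI : t ∈ Ioo (0:ℝ) T :=
      ⟨(le_min ha.1 hb.1).trans_lt ht.1,
        lt_of_le_of_ne (ht.2.trans (max_le ha.2 hb.2)) htT⟩
    rw [((hε.2.hasDerivWithinAt_comp hW hKW (hU.of_le (by norm_num))
      (Ioo_subset_Icc_self htI)).hasDerivAt (Icc_mem_nhds htI.1 htI.2)).deriv]
  obtain ⟨M, hM⟩ := exists_abs_integral_oscillation_le (T := T) hW hK hKW hΦ hpos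
    hV₀.continuousOn hV₁.continuousOn hG₀ hG₁
  obtain ⟨N, hN⟩ := hK.exists_bound_of_continuousOn (hG₁.continuousOn.mono hKW)
  refine ⟨?_, M, ?_⟩
  · have hlim : Tendsto (fun ε : ℝ => ∫ t in a..b, fderiv ℝ U (q ε t) (V₁ (q ε t)))
        (𝓝[>] (0:ℝ)) (𝓝 (∫ t in a..b, fderiv ℝ U (q₀ t) (V₁ (q₀ t)))) := by
      refine tendsto_integral_filter_of_dominated_convergence (fun _ => N) ?_ ?_
        intervalIntegrable_const ?_
      · filter_upwards [hev] with ε hε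
        exact (((hε.2.continuousOn_comp hG₁.continuousOn hKW).mono hsub).intervalIntegrable
          |>.def').aestronglyMeasurable
      · filter_upwards [hev] with ε hε
        exact .of_forall fun t ht => hN _ (hε.2.mem t (hsub (uIoc_subset_uIcc ht)))
      · refine .of_forall fun t ht => ?_
        have htI := hsub (uIoc_subset_uIcc ht)
        exact (hG₁.continuousOn.continuousAt (hW.mem_nhds (hq₀W t htI))).tendsto.comp
          (hconv.tendsto_at htI)
    have hdiff : Tendsto (fun ε : ℝ => (∫ t in a..b,
        deriv (fun s => U (q ε s)) t * Real.cos (2 * φ ε t / ε))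
        - 1 / 2 * ∫ t in a..b, fderiv ℝ U (q ε t) (V₁ (q ε t))) (𝓝[>] (0:ℝ)) (𝓝 0) := by
      refine squeeze_zero_norm' (a := fun ε => M * ε) ?_ ?_
      · filter_upwards [hev, hrepl] with ε hε hr
        rw [hr]
        exact (hM ε _ _ hε.1 hε.2 a ha b hb).2
      · have : Tendsto (fun ε : ℝ => M * ε) (𝓝 0) (𝓝 (M * 0)) := tendsto_id.const_mul M
        rw [mul_zero] at this
        exact this.mono_left nhdsWithin_le_nhds
    have hsum := hdiff.add (hlim.const_mul (1 / 2))
    rw [zero_add] at hsum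
    exact hsum.congr fun ε => by ring
  · filter_upwards [hev, hrepl] with ε hε hr
    rw [hr]
    exact (hM ε _ _ hε.1 hε.2 a ha b hb).1

end FastSlow

section ActionAngle

/-- The slow state `(θ, y, p, ε sin(2φ/ε))` of the action-angle system. -/
abbrev SlowState : Type := ℝ × ℝ × ℝ × ℝ

variable (ω : ℝ → ℝ)

/-- The right-hand side of the equation for `φ`. -/
noncomputable def phaseSpeed (x : SlowState) : ℝ :=
  ω x.2.1 + x.2.2.1 * deriv ω x.2.1 / (2 * ω x.2.1) * x.2.2.2
    + x.1 * deriv ω x.2.1 ^ 2 / (4 * ω x.2.1 ^ 2) * x.2.2.2 ^ 2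

/-- The right-hand side of the equation for `y`. -/
noncomputable def positionSpeed (x : SlowState) : ℝ :=
  x.2.2.1 + x.1 * deriv ω x.2.1 / (2 * ω x.2.1) * x.2.2.2

/-- The non-oscillating part of the vector field of the slow state. -/
noncomputable def meanField (x : SlowState) : SlowState :=
  (0, positionSpeed ω x,
    -(x.1 * deriv ω x.2.1)
      + x.1 * x.2.2.1 * deriv ω x.2.1 ^ 2 / (2 * ω x.2.1 ^ 2) * x.2.2.2
      - x.1 * x.2.2.1 * deriv (deriv ω) x.2.1 / (2 * ω x.2.1) * x.2.2.2
      + x.1 ^ 2 * deriv ω x.2.1 ^ 3 / (4 * ω x.2.1 ^ 3) * x.2.2.2 ^ 2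
      - x.1 ^ 2 * deriv ω x.2.1 * deriv (deriv ω) x.2.1 / (4 * ω x.2.1 ^ 2) * x.2.2.2 ^ 2,
    0)

/-- The coefficient of `cos(2φ/ε)` in the vector field of the slow state. -/
noncomputable def oscillatingField (x : SlowState) : SlowState :=
  (-(x.1 * x.2.2.1 * deriv ω x.2.1 / ω x.2.1)
      - x.1 ^ 2 * deriv ω x.2.1 ^ 2 / (2 * ω x.2.1 ^ 2) * x.2.2.2,
    0, 0, 2 * phaseSpeed ω x)

/-- The arguments `(φ̇, θ, ẏ, y)` as a function of the slow state. -/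
noncomputable def observedState (x : SlowState) : ℝ × ℝ × ℝ × ℝ :=
  (phaseSpeed ω x, x.1, positionSpeed ω x, x.2.1)

variable {ω}

lemma contDiff_deriv_of_smooth (hω : ContDiff ℝ (⊤ : ℕ∞) ω) :
    ContDiff ℝ (⊤ : ℕ∞) (deriv ω) :=
  (contDiff_infty_iff_deriv.1 hω).2

lemma contDiff_phaseSpeed (hω : ContDiff ℝ (⊤ : ℕ∞) ω) (hne : ∀ x, ω x ≠ 0) :
    ContDiff ℝ (⊤ : ℕ∞) (phaseSpeed ω) := by
  have hω₁ := contDiff_deriv_of_smooth hω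
  unfold phaseSpeed
  fun_prop (disch := simp [hne])

lemma contDiff_positionSpeed (hω : ContDiff ℝ (⊤ : ℕ∞) ω) (hne : ∀ x, ω x ≠ 0) :
    ContDiff ℝ (⊤ : ℕ∞) (positionSpeed ω) := by
  have hω₁ := contDiff_deriv_of_smooth hω
  unfold positionSpeed
  fun_prop (disch := simp [hne])

lemma contDiff_meanField (hω : ContDiff ℝ (⊤ : ℕ∞) ω) (hne : ∀ x, ω x ≠ 0) :
    ContDiff ℝ (⊤ : ℕ∞) (meanField ω) := by
  have hω₁ := contDiff_deriv_of_smooth hω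
  have hω₂ := contDiff_deriv_of_smooth hω₁
  have hY := contDiff_positionSpeed hω hne
  unfold meanField
  fun_prop (disch := simp [hne])

lemma contDiff_oscillatingField (hω : ContDiff ℝ (⊤ : ℕ∞) ω) (hne : ∀ x, ω x ≠ 0) :
    ContDiff ℝ (⊤ : ℕ∞) (oscillatingField ω) := by
  have hω₁ := contDiff_deriv_of_smooth hω
  have hΦ := contDiff_phaseSpeed hω hne
  unfold oscillatingField
  fun_prop (disch := simp [hne])

lemma contDiff_observedState (hω : ContDiff ℝ (⊤ : ℕ∞) ω) (hne : ∀ x, ω x ≠ 0) :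
    ContDiff ℝ (⊤ : ℕ∞) (observedState ω) := by
  have hΦ := contDiff_phaseSpeed hω hne
  have hY := contDiff_positionSpeed hω hne
  unfold observedState
  fun_prop

/-- The oscillating part of the derivative of an observable at a state with no fast component. -/
lemma fderiv_comp_observedState_oscillatingField (hω : ContDiff ℝ (⊤ : ℕ∞) ω)
    (hne : ∀ x, ω x ≠ 0) {u : ℝ × ℝ × ℝ × ℝ → ℝ} {θ y p : ℝ}
    (hu : DifferentiableAt ℝ u (ω y, θ, p, y)) :
    fderiv ℝ (fun x => u (observedState ω x)) (θ, y, p, 0) (oscillatingField ω (θ, y, p, 0))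
      = deriv ω y * p / ω y * (ω y * deriv (fun s => u (s, θ, p, y)) (ω y)
          - θ * deriv (fun s => u (ω y, s, p, y)) θ)
        + θ * deriv ω y * deriv (fun s => u (ω y, θ, s, y)) p := by
  have hy := hne y
  have hΨ0 : observedState ω (θ, y, p, 0) = (ω y, θ, p, y) := by
    simp [observedState, phaseSpeed, positionSpeed]
  set L := fderiv ℝ u (ω y, θ, p, y) with hL
  have hLu : HasFDerivAt u L (ω y, θ, p, y) := hu.hasFDerivAt
  have h₁ : HasDerivAt (fun s => u (s, θ, p, y)) (L (1, 0, 0, 0)) (ω y) :=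
    hLu.comp_hasDerivAt (ω y) ((hasDerivAt_id (ω y)).prodMk
      ((hasDerivAt_const (ω y) θ).prodMk
        ((hasDerivAt_const (ω y) p).prodMk (hasDerivAt_const (ω y) y))))
  have h₂ : HasDerivAt (fun s => u (ω y, s, p, y)) (L (0, 1, 0, 0)) θ :=
    hLu.comp_hasDerivAt θ ((hasDerivAt_const θ (ω y)).prodMk
      ((hasDerivAt_id θ).prodMk ((hasDerivAt_const θ p).prodMk (hasDerivAt_const θ y))))
  have h₃ : HasDerivAt (fun s => u (ω y, θ, s, y)) (L (0, 0, 1, 0)) p :=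
    hLu.comp_hasDerivAt p ((hasDerivAt_const p (ω y)).prodMk
      ((hasDerivAt_const p θ).prodMk ((hasDerivAt_id p).prodMk (hasDerivAt_const p y))))
  have hΨ : HasFDerivAt (observedState ω) (fderiv ℝ (observedState ω) (θ, y, p, 0))
      (θ, y, p, 0) :=
    ((contDiff_observedState hω hne).differentiable (by simp) _).hasFDerivAt
  have hchain : fderiv ℝ (fun x => u (observedState ω x)) (θ, y, p, 0)
      = L.comp (fderiv ℝ (observedState ω) (θ, y, p, 0)) :=
    (HasFDerivAt.comp (θ, y, p, 0) (by rwa [hΨ0]) hΨ).fderiv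
  set c := -(θ * p * deriv ω y / ω y) with hc
  have hV : oscillatingField ω (θ, y, p, 0) = (c, 0, 0, 2 * ω y) := by
    simp [oscillatingField, phaseSpeed, hc]
  have hline : HasDerivAt (fun r : ℝ => ((θ + r * c, y, p, r * (2 * ω y)) : SlowState))
      (c, 0, 0, 2 * ω y) 0 := by
    refine HasDerivAt.prodMk ?_ ((hasDerivAt_const _ _).prodMk
      ((hasDerivAt_const _ _).prodMk ?_))
    · simpa using ((hasDerivAt_id (0:ℝ)).mul_const c).const_add θ
    · simpa using (hasDerivAt_id (0:ℝ)).mul_const (2 * ω y)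
  have hΨline : HasFDerivAt (observedState ω) (fderiv ℝ (observedState ω) (θ, y, p, 0))
      (θ + 0 * c, y, p, 0 * (2 * ω y)) := by simpa using hΨ
  have hleft : HasDerivAt (fun r : ℝ => observedState ω (θ + r * c, y, p, r * (2 * ω y)))
      (fderiv ℝ (observedState ω) (θ, y, p, 0) (c, 0, 0, 2 * ω y)) 0 :=
    HasFDerivAt.comp_hasDerivAt (l := observedState ω) (0:ℝ) hΨline hline
  have hpoly : ∀ A B C D : ℝ, HasDerivAt
      (fun r : ℝ => A + B * (r * (2 * ω y)) + (C + r * c) * D * (r * (2 * ω y)) ^ 2)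
      (B * (2 * ω y)) 0 := fun A B C D => by
    have hr := hasDerivAt_id (0:ℝ)
    refine (((hr.mul_const (2 * ω y)).const_mul B).const_add A |>.add
      ((((hr.mul_const c).const_add C).mul_const D).mul
        ((hr.mul_const (2 * ω y)).pow 2))).congr_deriv ?_
    simp
  have hright : HasDerivAt (fun r : ℝ => observedState ω (θ + r * c, y, p, r * (2 * ω y)))
      (p * deriv ω y, c, θ * deriv ω y, 0) 0 := by
    refine HasDerivAt.prodMk ?_ (HasDerivAt.prodMk ?_ (HasDerivAt.prodMk ?_
      (hasDerivAt_const _ _)))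
    · refine ((hpoly (ω y) (p * deriv ω y / (2 * ω y)) θ
        (deriv ω y ^ 2 / (4 * ω y ^ 2))).congr_deriv (by field_simp)).congr_of_eventuallyEq
        (.of_forall fun r => ?_)
      simp only [phaseSpeed]
      ring
    · simpa using ((hasDerivAt_id (0:ℝ)).mul_const c).const_add θ
    · have hr := hasDerivAt_id (0:ℝ)
      refine ((((hr.mul_const c).const_add θ).mul_const (deriv ω y)).div_const (2 * ω y)
        |>.mul (hr.mul_const (2 * ω y)) |>.const_add p).congr_deriv ?_
      simp
      field_simp
  have hdecomp : ((p * deriv ω y, c, θ * deriv ω y, 0) : ℝ × ℝ × ℝ × ℝ)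
      = (p * deriv ω y) • (1, 0, 0, 0) + c • (0, 1, 0, 0) + (θ * deriv ω y) • (0, 0, 1, 0) := by
    simp
  rw [hchain, hV, ContinuousLinearMap.comp_apply, hleft.unique hright, hdecomp, map_add, map_add,
    map_smul, map_smul, map_smul, h₁.deriv, h₂.deriv, h₃.deriv, hc]
  simp only [smul_eq_mul]
  field_simp
  ring

end ActionAngle

/-- For `u ∈ C²(ℝ_{>0} × ℝ³)` and
`u_ε(t) := u(φ̇_ε(t), θ_ε(t), ẏ_ε(t), y_ε(t))`, for all `a, b ∈ [0,T]`,
`∫_a^b u̇_ε cos(2φ_ε/ε) dt → ½∫_a^b [(d/dt log ω(y₀))(ω(y₀)∂₁u₀ − θ_*∂₂u₀)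
+ θ_*ω'(y₀)∂₃u₀] dt` and `∫_a^b u̇_ε sin(2φ_ε/ε) dt = O(ε)`,
where `u₀ = u(ω(y₀), θ_*, p₀, y₀)`. -/
theorem stmt11 (T : ℝ) (hT : 0 < T)
    (ω : ℝ → ℝ) (hω : ContDiff ℝ (⊤ : ℕ∞) ω)
    (ωs : ℝ) (hωs : 0 < ωs) (hωlb : ∀ x, ωs ≤ ω x)
    (φ θ y p : ℝ → ℝ → ℝ)
    (hreg : ∀ ε > (0:ℝ), ContDiff ℝ 1 (φ ε) ∧ ContDiff ℝ 1 (θ ε) ∧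
      ContDiff ℝ 1 (y ε) ∧ ContDiff ℝ 1 (p ε))
    (ys ps us θs : ℝ) (hθs : θs = us ^ 2 / (2 * ω ys))
    (hinit : ∀ ε > (0:ℝ), φ ε 0 = 0 ∧ θ ε 0 = θs ∧ y ε 0 = ys ∧ p ε 0 = ps)
    (hφode : ∀ ε > (0:ℝ), ∀ t ∈ Icc (0:ℝ) T,
      deriv (φ ε) t = ω (y ε t)
        + ε * (p ε t * deriv ω (y ε t) / (2 * ω (y ε t))) * Real.sin (2 * φ ε t / ε)
        + ε ^ 2 * (θ ε t * (deriv ω (y ε t)) ^ 2 / (4 * (ω (y ε t)) ^ 2))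
            * (Real.sin (2 * φ ε t / ε)) ^ 2)
    (hθode : ∀ ε > (0:ℝ), ∀ t ∈ Icc (0:ℝ) T,
      deriv (θ ε) t
        = -(θ ε t * p ε t * deriv ω (y ε t) / ω (y ε t)) * Real.cos (2 * φ ε t / ε)
          - ε * ((θ ε t) ^ 2 * (deriv ω (y ε t)) ^ 2 / (4 * (ω (y ε t)) ^ 2))
              * Real.sin (4 * φ ε t / ε))
    (hyode : ∀ ε > (0:ℝ), ∀ t ∈ Icc (0:ℝ) T,
      deriv (y ε) t = p ε t
        + ε * (θ ε t * deriv ω (y ε t) / (2 * ω (y ε t))) * Real.sin (2 * φ ε t / ε))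
    (hpode : ∀ ε > (0:ℝ), ∀ t ∈ Icc (0:ℝ) T,
      deriv (p ε) t = -(θ ε t * deriv ω (y ε t))
        + ε * (θ ε t * p ε t * (deriv ω (y ε t)) ^ 2 / (2 * (ω (y ε t)) ^ 2))
            * Real.sin (2 * φ ε t / ε)
        - ε * (θ ε t * p ε t * deriv (deriv ω) (y ε t) / (2 * ω (y ε t)))
            * Real.sin (2 * φ ε t / ε)
        + ε ^ 2 * ((θ ε t) ^ 2 * (deriv ω (y ε t)) ^ 3 / (4 * (ω (y ε t)) ^ 3))
            * (Real.sin (2 * φ ε t / ε)) ^ 2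
        - ε ^ 2 * ((θ ε t) ^ 2 * deriv ω (y ε t) * deriv (deriv ω) (y ε t)
              / (4 * (ω (y ε t)) ^ 2))
            * (Real.sin (2 * φ ε t / ε)) ^ 2)
    (φ₀ y₀ p₀ : ℝ → ℝ)
    (hlimreg : ContDiff ℝ 1 φ₀ ∧ ContDiff ℝ 1 y₀ ∧ ContDiff ℝ 1 p₀)
    (hliminit : φ₀ 0 = 0 ∧ y₀ 0 = ys ∧ p₀ 0 = ps)
    (hlimode : ∀ t ∈ Icc (0:ℝ) T,
      deriv φ₀ t = ω (y₀ t) ∧ deriv y₀ t = p₀ t ∧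
      deriv p₀ t = -(θs * deriv ω (y₀ t)))
    (hconv_y : TendstoUniformlyOn (fun ε t => y ε t) y₀ (𝓝[>] (0:ℝ)) (Icc 0 T))
    (hconv_p : TendstoUniformlyOn (fun ε t => p ε t) p₀ (𝓝[>] (0:ℝ)) (Icc 0 T))
    (hconv_θ : TendstoUniformlyOn (fun ε t => θ ε t) (fun _ => θs) (𝓝[>] (0:ℝ)) (Icc 0 T))
    (hconv_φ : TendstoUniformlyOn (fun ε t => φ ε t) φ₀ (𝓝[>] (0:ℝ)) (Icc 0 T))
    (u : ℝ × ℝ × ℝ × ℝ → ℝ)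
    (hu : ContDiffOn ℝ 2 u {x : ℝ × ℝ × ℝ × ℝ | 0 < x.1}) :
    ∀ a ∈ Icc (0:ℝ) T, ∀ b ∈ Icc (0:ℝ) T,
      Tendsto (fun ε : ℝ =>
          ∫ t in a..b,
            deriv (fun s => u (deriv (φ ε) s, θ ε s, deriv (y ε) s, y ε s)) t
              * Real.cos (2 * φ ε t / ε))
        (𝓝[>] (0:ℝ))
        (𝓝 ((1/2) * ∫ t in a..b,
          (deriv ω (y₀ t) * p₀ t / ω (y₀ t))
              * (ω (y₀ t) * deriv (fun s => u (s, θs, p₀ t, y₀ t)) (ω (y₀ t))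
                 - θs * deriv (fun s => u (ω (y₀ t), s, p₀ t, y₀ t)) θs)
            + θs * deriv ω (y₀ t)
                * deriv (fun s => u (ω (y₀ t), θs, s, y₀ t)) (p₀ t))) ∧
      ∃ K : ℝ, ∃ ε₀ > (0:ℝ), ∀ ε : ℝ, 0 < ε → ε < ε₀ →
        |∫ t in a..b,
            deriv (fun s => u (deriv (φ ε) s, θ ε s, deriv (y ε) s, y ε s)) t
              * Real.sin (2 * φ ε t / ε)| ≤ K * ε := by
  intro a ha b hb
  have hpos : ∀ x, 0 < ω x := fun x => hωs.trans_le (hωlb x)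
  have hne : ∀ x, ω x ≠ 0 := fun x => (hpos x).ne'
  set W : Set SlowState := {x | 0 < phaseSpeed ω x} with hWdef
  have hΦ := contDiff_phaseSpeed hω hne
  have hW : IsOpen W := isOpen_lt continuous_const hΦ.continuous
  have hU : ContDiffOn ℝ 2 (fun x => u (observedState ω x)) W :=
    hu.comp (contDiff_infty.1 (contDiff_observedState hω hne) 2).contDiffOn
      fun x hx => hx
  set q : ℝ → ℝ → SlowState :=
    fun ε t => (θ ε t, y ε t, p ε t, ε * Real.sin (2 * φ ε t / ε)) with hq
  set q₀ : ℝ → SlowState := fun t => (θs, y₀ t, p₀ t, 0) with hq₀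
  have hphase : ∀ ε > (0:ℝ), ∀ t ∈ Icc (0:ℝ) T,
      deriv (φ ε) t = phaseSpeed ω (q ε t) := fun ε hε t ht => by
    rw [hφode ε hε t ht]
    simp only [phaseSpeed, hq]
    ring
  have hposition : ∀ ε > (0:ℝ), ∀ t ∈ Icc (0:ℝ) T,
      deriv (y ε) t = positionSpeed ω (q ε t) := fun ε hε t ht => by
    rw [hyode ε hε t ht]
    simp only [positionSpeed, hq]
    ring
  have hsol : ∀ ε > (0:ℝ),
      IsFastSlow T univ (phaseSpeed ω) (meanField ω) (oscillatingField ω) ε (φ ε) (q ε) := by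
    intro ε hε
    obtain ⟨hφ1, hθ1, hy1, hp1⟩ := hreg ε hε
    have hder : ∀ {f : ℝ → ℝ}, ContDiff ℝ 1 f → ∀ t, HasDerivAt f (deriv f t) t :=
      fun hf t => (hf.differentiable one_ne_zero t).hasDerivAt
    refine ⟨fun _ _ => mem_univ _, fun t ht => ?_, fun t ht => ?_⟩
    · have hsin : HasDerivAt (fun s => ε * Real.sin (2 * φ ε s / ε))
          (ε * (Real.cos (2 * φ ε t / ε) * (2 * deriv (φ ε) t / ε))) t :=
        ((((hder hφ1 t).const_mul 2).div_const ε).sin).const_mul ε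
      refine ((hder hθ1 t).prodMk ((hder hy1 t).prodMk
        ((hder hp1 t).prodMk hsin))).hasDerivWithinAt.congr_deriv ?_
      have h4 : 4 * φ ε t / ε = 2 * (2 * φ ε t / ε) := by ring
      rw [hphase ε hε t ht, hposition ε hε t ht, hθode ε hε t ht, hpode ε hε t ht, h4,
        Real.sin_two_mul]
      simp only [meanField, oscillatingField, Prod.smul_mk, Prod.mk_add_mk, smul_eq_mul,
        Prod.mk.injEq, hq]
      refine ⟨by ring, by ring, by ring, ?_⟩
      field_simp
      ring
    · rw [← hphase ε hε t ht]
      exact (hder hφ1 t).hasDerivWithinAt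
  have hconv : TendstoUniformlyOn q q₀ (𝓝[>] (0:ℝ)) (Icc 0 T) := by
    have hsin : TendstoUniformlyOn (fun ε t => ε * Real.sin (2 * φ ε t / ε))
        (fun _ => 0) (𝓝[>] (0:ℝ)) (Icc 0 T) := by
      refine Metric.tendstoUniformlyOn_iff.2 fun δ hδ => ?_
      filter_upwards [Ioo_mem_nhdsGT hδ] with ε hε t _
      rw [dist_comm, Real.dist_0_eq_abs, abs_mul, abs_of_pos hε.1]
      exact (mul_le_of_le_one_right hε.1.le (Real.abs_sin_le_one _)).trans_lt hε.2
    rw [Metric.tendstoUniformlyOn_iff] at *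
    intro δ hδ
    filter_upwards [hconv_θ δ hδ, hconv_y δ hδ, hconv_p δ hδ, hsin δ hδ] with ε h1 h2 h3 h4 t ht
    simp only [hq, hq₀, Prod.dist_eq, max_lt_iff]
    exact ⟨h1 t ht, h2 t ht, h3 t ht, h4 t ht⟩
  have hq₀c : ContinuousOn q₀ (Icc 0 T) :=
    (continuous_const.prodMk (hlimreg.2.1.continuous.prodMk
      (hlimreg.2.2.continuous.prodMk continuous_const))).continuousOn
  have hq₀W : ∀ t ∈ Icc (0:ℝ) T, q₀ t ∈ W := fun t _ => by
    simpa [hWdef, hq₀, phaseSpeed] using hpos (y₀ t)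
  obtain ⟨hcos, M, hsin⟩ := tendsto_integral_deriv_mul_cos hW
    ((hΦ.of_le (by exact_mod_cast le_top)).contDiffOn) (fun _ hx => hx)
    (((contDiff_meanField hω hne).of_le (by exact_mod_cast le_top)).contDiffOn)
    (((contDiff_oscillatingField hω hne).of_le (by exact_mod_cast le_top)).contDiffOn)
    hU hq₀c hq₀W hconv hsol ha hb
  have hint : ∀ ε > (0:ℝ), ∀ f : ℝ → ℝ,
      ∫ t in a..b, deriv (fun s => u (observedState ω (q ε s))) t * f t
        = ∫ t in a..b, deriv (fun s => u (deriv (φ ε) s, θ ε s, deriv (y ε) s, y ε s)) t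
            * f t := by
    intro ε hε f
    refine integral_congr_ae ?_
    have hT' : ∀ᵐ t : ℝ, t ≠ T := by simp [MeasureTheory.ae_iff]
    filter_upwards [hT'] with t htT ht
    have htI : t ∈ Ioo (0:ℝ) T :=
      ⟨(le_min ha.1 hb.1).trans_lt ht.1, lt_of_le_of_ne (ht.2.trans (max_le ha.2 hb.2)) htT⟩
    congr 1
    refine Filter.EventuallyEq.deriv_eq ?_
    filter_upwards [Icc_mem_nhds htI.1 htI.2] with s hs
    rw [hphase ε hε s hs, hposition ε hε s hs]
    rfl
  constructor
  · have hlimit : ∀ t, fderiv ℝ (fun x => u (observedState ω x)) (q₀ t)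
        (oscillatingField ω (q₀ t)) = _ := fun t =>
      fderiv_comp_observedState_oscillatingField hω hne (θ := θs) (y := y₀ t) (p := p₀ t)
        ((hu.differentiableOn two_ne_zero).differentiableAt
          ((isOpen_lt continuous_const continuous_fst).mem_nhds (hpos (y₀ t))))
    simp only [hlimit] at hcos
    refine hcos.congr' ?_
    filter_upwards [self_mem_nhdsWithin] with ε hε
    exact hint ε hε _
  · obtain ⟨ε₀, hε₀, hsub⟩ := mem_nhdsGT_iff_exists_Ioo_subset.1 hsin
    refine ⟨M, ε₀, hε₀, fun ε hε hlt => ?_⟩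
    rw [← hint ε hε]
    exact hsub ⟨hε, hlt⟩
end
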